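/- Let Ω(n,p) be a K-invariant open subset of J^k(n,p), and let (K,L) be a pair consisting of a finite simplicial complex K and a subcomplex L such that K∖L is a manifold, dim L < dim K, and dim K < p. Let ψ : (K,L) → (Ω_K(n+1,p+1), i_{+1}(Ω(n,p))) be a continuous map of pairs such that ψ restricted to K∖L is smooth. Then there exists a homotopy Ψ_λ : (K,L) → (Ω_K(n+1,p+1), i_{+1}(Ω(n,p))) with (i) Ψ_0 = ψ, (ii) Ψ_λ|L = ψ|L for all λ, and (iii) Ψ_1(K) ⊆ i_{+1}(Ω(n,p)). -/

import Mathlib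

open scoped Topology unitInterval
open Filter Asymptotics
open scoped Manifold

namespace AndoCob


/-! ### Jet spaces -/

/-- The space of `k`-jets at the origin of smooth map germs `(ℝⁿ,0) → (ℝᵖ,0)`,
modeled by `p`-tuples of real polynomials in `n` variables with vanishing constant
term and total degree at most `k`.  This realizes
`J^k(n,p) = ⊕_{i=1}^k Hom(Sⁱ(ℝⁿ), ℝᵖ)`. -/
def JetSpace (k n p : ℕ) : Type :=
  { z : Fin p → MvPolynomial (Fin n) ℝ //
    ∀ j, (z j).totalDegree ≤ k ∧ MvPolynomial.constantCoeff (z j) = 0 }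

/-- The (finitely many) coefficients of a jet. -/
noncomputable def jetCoeffs {k n p : ℕ} (z : JetSpace k n p) :
    Fin p → (Fin n → Fin (k + 1)) → ℝ := fun j e =>
  MvPolynomial.coeff (Finsupp.equivFunOnFinite.symm fun i => (e i : ℕ)) (z.1 j)

/-- The (euclidean) topology on a jet space, induced by the coefficients. -/
noncomputable instance {k n p : ℕ} : TopologicalSpace (JetSpace k n p) :=
  TopologicalSpace.induced jetCoeffs inferInstance

/-- Evaluation of the polynomial representative of a jet. -/
noncomputable def JetSpace.eval {k n p : ℕ} (z : JetSpace k n p) (x : Fin n → ℝ) :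
    Fin p → ℝ := fun j => MvPolynomial.eval x (z.1 j)

/-- `z` is the `k`-jet at `0` of the map `f` : `f` agrees with the polynomial
representative of `z` to order `> k` at the origin. -/
def IsJetAt {k n p : ℕ} (z : JetSpace k n p) (f : (Fin n → ℝ) → Fin p → ℝ) : Prop :=
  (fun x => f x - z.eval x) =o[𝓝 (0 : Fin n → ℝ)] fun x => ‖x‖ ^ k

/-- `z` is the `k`-jet at `0` of `f` along the set `s` (for manifolds with boundary). -/
def IsJetWithinAt {k n p : ℕ} (z : JetSpace k n p) (f : (Fin n → ℝ) → Fin p → ℝ)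
    (s : Set (Fin n → ℝ)) : Prop :=
  (fun x => f x - z.eval x) =o[𝓝[s] (0 : Fin n → ℝ)] fun x => ‖x‖ ^ k

/-! ### Germs at the origin, diffeomorphism germs, contact equivalence -/

/-- `f` is smooth on a neighbourhood of the origin. -/
def SmoothGermAtZero {n p : ℕ} (f : (Fin n → ℝ) → Fin p → ℝ) : Prop :=
  ∃ U ∈ 𝓝 (0 : Fin n → ℝ), ContDiffOn ℝ (⊤ : ℕ∞) f U

/-- `h` is (a representative of) a germ of diffeomorphism of `(ℝⁿ,0)`:
it fixes the origin, is smooth near the origin and its differential at the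
origin is invertible (by the inverse function theorem this is equivalent to
being a diffeomorphism germ). -/
def DiffeoGermAtZero {n : ℕ} (h : (Fin n → ℝ) → Fin n → ℝ) : Prop :=
  h 0 = 0 ∧ SmoothGermAtZero h ∧ Function.Bijective (fderiv ℝ h 0)

/-- Contact (Mather's group `𝒦`) equivalence of two map germs:
`g x = M x • f (h x)` near the origin, for a diffeomorphism germ `h` of the
source and a smooth germ `M` of invertible matrices. -/
def KEquivGerm {n p : ℕ} (f g : (Fin n → ℝ) → Fin p → ℝ) : Prop :=
  ∃ (h : (Fin n → ℝ) → Fin n → ℝ) (M : (Fin n → ℝ) → Matrix (Fin p) (Fin p) ℝ),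
    DiffeoGermAtZero h ∧
    (∃ U ∈ 𝓝 (0 : Fin n → ℝ), ContDiffOn ℝ (⊤ : ℕ∞) (fun x (i : Fin p) (j : Fin p) => M x i j) U) ∧
    IsUnit (M 0) ∧
    (∀ᶠ x in 𝓝 (0 : Fin n → ℝ), g x = (M x).mulVec (f (h x)))

/-- Contact equivalence of `k`-jets: the jets admit smooth representatives
that are `𝒦`-equivalent as germs. -/
def KEquiv {k n p : ℕ} (z w : JetSpace k n p) : Prop :=
  ∃ f g : (Fin n → ℝ) → Fin p → ℝ,
    SmoothGermAtZero f ∧ SmoothGermAtZero g ∧ f 0 = 0 ∧ g 0 = 0 ∧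
    IsJetAt z f ∧ IsJetAt w g ∧ KEquivGerm f g

/-- The `𝒦`-orbit of a jet. -/
def KOrbit {k n p : ℕ} (z : JetSpace k n p) : Set (JetSpace k n p) := {w | KEquiv z w}

/-- A set of jets invariant under the contact group. -/
def KInvariant {k n p : ℕ} (Ω : Set (JetSpace k n p)) : Prop :=
  ∀ z ∈ Ω, ∀ w, KEquiv z w → w ∈ Ω

/-- Right-left equivalence of jets (the action of `L^k(p) × L^k(n)`):
the jets admit smooth representatives `f`, `g` with `g = ψ ∘ f ∘ φ` near `0`
for diffeomorphism germs `φ` of `(ℝⁿ,0)` and `ψ` of `(ℝᵖ,0)`. -/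
def RLEquiv {k n p : ℕ} (z w : JetSpace k n p) : Prop :=
  ∃ (f g : (Fin n → ℝ) → Fin p → ℝ) (φ : (Fin n → ℝ) → Fin n → ℝ)
    (ψ : (Fin p → ℝ) → Fin p → ℝ),
    SmoothGermAtZero f ∧ SmoothGermAtZero g ∧ f 0 = 0 ∧ g 0 = 0 ∧
    DiffeoGermAtZero φ ∧ DiffeoGermAtZero ψ ∧
    IsJetAt z f ∧ IsJetAt w g ∧ (∀ᶠ x in 𝓝 (0 : Fin n → ℝ), g x = ψ (f (φ x)))

/-- Invariance under the action of `L^k(p) × L^k(n)`. -/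
def LInvariant {k n p : ℕ} (Ω : Set (JetSpace k n p)) : Prop :=
  ∀ z ∈ Ω, ∀ w, RLEquiv z w → w ∈ Ω



/-! ### Truncation and algebraic operations on jets -/

/-- Truncation of a polynomial: keep only the monomials of degree between `1` and `k`. -/
noncomputable def truncPoly (k : ℕ) {n : ℕ} (φ : MvPolynomial (Fin n) ℝ) :
    MvPolynomial (Fin n) ℝ :=
  ∑ d ∈ φ.support.filter fun d : Fin n →₀ ℕ =>
      1 ≤ (d.sum fun _ e => e) ∧ (d.sum fun _ e => e) ≤ k,
    MvPolynomial.monomial d (MvPolynomial.coeff d φ)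

theorem truncPoly_totalDegree_le (k : ℕ) {n : ℕ} (φ : MvPolynomial (Fin n) ℝ) :
    (truncPoly k φ).totalDegree ≤ k := by
  classical
  refine le_trans (MvPolynomial.totalDegree_finset_sum _ _) ?_
  refine Finset.sup_le fun d hd => ?_
  simp only [Finset.mem_filter] at hd
  refine le_trans (MvPolynomial.totalDegree_monomial_le _ _) ?_
  simpa [Finsupp.sum] using hd.2.2

theorem truncPoly_constantCoeff (k : ℕ) {n : ℕ} (φ : MvPolynomial (Fin n) ℝ) :
    MvPolynomial.constantCoeff (truncPoly k φ) = 0 := by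
  classical
  rw [truncPoly, map_sum]
  refine Finset.sum_eq_zero fun d hd => ?_
  simp only [Finset.mem_filter] at hd
  have hd0 : d ≠ 0 := by
    intro h
    rw [h] at hd
    simp [Finsupp.sum_zero_index] at hd
  simp [MvPolynomial.constantCoeff_monomial, hd0]

/-- Build a jet from an arbitrary tuple of polynomials by truncation. -/
noncomputable def truncJet (k n p : ℕ) (q : Fin p → MvPolynomial (Fin n) ℝ) :
    JetSpace k n p :=
  ⟨fun j => truncPoly k (q j), fun j =>
    ⟨truncPoly_totalDegree_le k (q j), truncPoly_constantCoeff k (q j)⟩⟩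

/-- Precomposition of a jet with the linear map `x ↦ A x`, `A : Matrix (Fin m) (Fin m') ℝ`
(substituting the `i`-th variable by the linear form `∑ i', A i i' • X i'`). -/
noncomputable def jetPrecomp {k m p : ℕ} {m' : ℕ} (A : Matrix (Fin m) (Fin m') ℝ)
    (z : JetSpace k m p) : JetSpace k m' p :=
  truncJet k m' p fun j =>
    MvPolynomial.aeval (fun i : Fin m => ∑ i', MvPolynomial.C (A i i') * MvPolynomial.X i')
      (z.1 j)

/-- Postcomposition of a jet with the linear map given by `B : Matrix (Fin q) (Fin p) ℝ`. -/
noncomputable def jetPostcomp {k m p q : ℕ} (B : Matrix (Fin q) (Fin p) ℝ)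
    (z : JetSpace k m p) : JetSpace k m q :=
  truncJet k m q fun j => ∑ j', MvPolynomial.C (B j j') * z.1 j'

/-! ### The stabilization `i₊` -/

/-- The map `i_{+1} : J^k(n,p) → J^k(n+1,p+1)`, `j^k₀ f ↦ j^k₀ (f × id_ℝ)`. -/
noncomputable def iPlusOne {k n p : ℕ} (hk : 1 ≤ k) (z : JetSpace k n p) :
    JetSpace k (n + 1) (p + 1) :=
  ⟨Fin.snoc (fun j => MvPolynomial.rename Fin.castSucc (z.1 j))
      (MvPolynomial.X (Fin.last n)), by
    intro j
    refine Fin.lastCases ?_ (fun j => ?_) j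
    · constructor
      · simpa [Fin.snoc_last] using hk
      · simp [Fin.snoc_last]
    · simp only [Fin.snoc_castSucc]
      exact ⟨le_trans (MvPolynomial.totalDegree_rename_le _ _) (z.2 j).1, by
        simp [MvPolynomial.constantCoeff_rename, (z.2 j).2]⟩⟩

/-- The iterated stabilization `i_{+m} : J^k(n,p) → J^k(n+m,p+m)`. -/
noncomputable def iPlus {k n p : ℕ} (hk : 1 ≤ k) :
    (m : ℕ) → JetSpace k n p → JetSpace k (n + m) (p + m)
  | 0 => id
  | m + 1 => fun z => iPlusOne hk (iPlus hk m z)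


/-- `Ω_𝒦(n+m,p+m)` : the union of all `𝒦`-orbits `𝒦(i_{+m}(z))` for `z ∈ Ω(n,p)`. -/
def OmegaK {k n p : ℕ} (hk : 1 ≤ k) (Ω : Set (JetSpace k n p)) (m : ℕ) :
    Set (JetSpace k (n + m) (p + m)) :=
  {w | ∃ z ∈ Ω, KEquiv (iPlus hk m z) w}

/-- The linear part (first differential at the origin) of a jet. -/
noncomputable def jetLinearPart {k m q : ℕ} (z : JetSpace k m q) :
    Matrix (Fin q) (Fin m) ℝ :=
  Matrix.of fun j i => MvPolynomial.coeff (Finsupp.single i 1) (z.1 j)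

/-- `Σ^i(m,q)` : the jets whose linear part has kernel of dimension exactly `i`. -/
def SigmaI {k : ℕ} (m q i : ℕ) : Set (JetSpace k m q) :=
  {z | Module.finrank ℝ (LinearMap.ker (jetLinearPart z).mulVecLin) = i}

/-- smooth germ, eventual form -/
def SG {n : ℕ} {F : Type} [NormedAddCommGroup F] [NormedSpace ℝ F]
    (f : (Fin n → ℝ) → F) : Prop :=
  ∀ᶠ x in 𝓝 (0 : Fin n → ℝ), ContDiffAt ℝ ((⊤ : ℕ∞) : WithTop ℕ∞) f x

theorem sg_iff {n : ℕ} {F : Type} [NormedAddCommGroup F] [NormedSpace ℝ F]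
    (f : (Fin n → ℝ) → F) :
    (∃ U ∈ 𝓝 (0 : Fin n → ℝ), ContDiffOn ℝ (⊤ : ℕ∞) f U) ↔ SG f := by
  constructor
  · rintro ⟨U, hU, hf⟩
    filter_upwards [eventually_mem_nhds_iff.2 hU] with x hx
    exact hf.contDiffAt hx
  · intro h
    exact ⟨_, h, fun x hx => ContDiffAt.contDiffWithinAt hx⟩

theorem SG.at0 {n : ℕ} {F : Type} [NormedAddCommGroup F] [NormedSpace ℝ F]
    {f : (Fin n → ℝ) → F} (h : SG f) : ContDiffAt ℝ ((⊤ : ℕ∞) : WithTop ℕ∞) f 0 :=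
  h.self_of_nhds

theorem SG.diff {n : ℕ} {F : Type} [NormedAddCommGroup F] [NormedSpace ℝ F]
    {f : (Fin n → ℝ) → F} (h : SG f) : DifferentiableAt ℝ f 0 :=
  h.at0.differentiableAt (by simp)

theorem SG.cont {n : ℕ} {F : Type} [NormedAddCommGroup F] [NormedSpace ℝ F]
    {f : (Fin n → ℝ) → F} (h : SG f) : ContinuousAt f 0 :=
  h.at0.continuousAt

theorem SG.comp {n m : ℕ} {F : Type} [NormedAddCommGroup F] [NormedSpace ℝ F]
    {f : (Fin n → ℝ) → F} (hf : SG f) {h : (Fin m → ℝ) → (Fin n → ℝ)} (hh : SG h)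
    (h0 : h 0 = 0) : SG (fun x => f (h x)) := by
  have ht : Tendsto h (𝓝 0) (𝓝 0) := by simpa [h0, ContinuousAt] using hh.cont
  filter_upwards [ht.eventually hf, hh] with x h1 h2
  exact h1.comp x h2

theorem sg_of_contDiff {n : ℕ} {F : Type} [NormedAddCommGroup F] [NormedSpace ℝ F]
    {f : (Fin n → ℝ) → F} (h : ContDiff ℝ ((⊤ : ℕ∞) : WithTop ℕ∞) f) : SG f :=
  Eventually.of_forall fun _ => h.contDiffAt

theorem sg_pi {n : ℕ} {ι : Type} [Fintype ι] {f : (Fin n → ℝ) → ι → ℝ} :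
    SG f ↔ ∀ i, SG (fun x => f x i) := by
  simp only [SG, contDiffAt_pi]
  exact eventually_all

theorem SG.mul {n : ℕ} {f g : (Fin n → ℝ) → ℝ} (hf : SG f) (hg : SG g) :
    SG (fun x => f x * g x) := by
  filter_upwards [hf, hg] with x h1 h2
  exact h1.mul h2

theorem SG.sub {n : ℕ} {f g : (Fin n → ℝ) → ℝ} (hf : SG f) (hg : SG g) :
    SG (fun x => f x - g x) := by
  filter_upwards [hf, hg] with x h1 h2
  exact h1.sub h2

theorem SG.sum {n : ℕ} {ι : Type} (s : Finset ι) {f : ι → (Fin n → ℝ) → ℝ}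
    (hf : ∀ i, SG (f i)) : SG (fun x => ∑ i ∈ s, f i x) := by
  have : ∀ᶠ x in 𝓝 (0 : Fin n → ℝ), ∀ i ∈ s, ContDiffAt ℝ ((⊤ : ℕ∞) : WithTop ℕ∞) (f i) x :=
    (Filter.eventually_all_finset s).2 fun i _ => hf i
  filter_upwards [this] with x h1
  exact ContDiffAt.sum h1

theorem SG.inv {n : ℕ} {f : (Fin n → ℝ) → ℝ} (hf : SG f) (h0 : f 0 ≠ 0) :
    SG (fun x => (f x)⁻¹) := by
  filter_upwards [hf, hf.cont.eventually_ne h0] with x h1 h2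
  exact h1.inv h2

theorem SG.prod {n : ℕ} {ι : Type} (s : Finset ι) {f : ι → (Fin n → ℝ) → ℝ}
    (hf : ∀ i, SG (f i)) : SG (fun x => ∏ i ∈ s, f i x) := by
  have : ∀ᶠ x in 𝓝 (0 : Fin n → ℝ), ∀ i ∈ s, ContDiffAt ℝ ((⊤ : ℕ∞) : WithTop ℕ∞) (f i) x :=
    (Filter.eventually_all_finset s).2 fun i _ => hf i
  filter_upwards [this] with x h1
  exact contDiffAt_prod h1

theorem SG.det {n p : ℕ} {M : (Fin n → ℝ) → Matrix (Fin p) (Fin p) ℝ}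
    (hM : ∀ i j, SG (fun x => M x i j)) : SG (fun x => (M x).det) := by
  simp only [Matrix.det_apply']
  exact SG.sum _ fun τ => (sg_of_contDiff contDiff_const).mul (SG.prod _ fun i => hM _ _)

theorem SG.matinv {n p : ℕ} {M : (Fin n → ℝ) → Matrix (Fin p) (Fin p) ℝ}
    (hM : ∀ i j, SG (fun x => M x i j)) (h0 : IsUnit (M 0)) :
    ∀ i j, SG (fun x => (M x)⁻¹ i j) := by
  intro i j
  have hd : (M 0).det ≠ 0 := ((Matrix.isUnit_iff_isUnit_det _).1 h0).ne_zero
  have : (fun x => (M x)⁻¹ i j) = fun x => (M x).det⁻¹ * ((M x).updateRow j (Pi.single i 1)).det := by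
    funext x
    simp [Matrix.inv_def, Matrix.adjugate_apply]
  rw [this]
  refine ((SG.det hM).inv hd).mul (SG.det fun a b => ?_)
  by_cases h : a = j
  · subst h; simp only [Matrix.updateRow_self]; exact sg_of_contDiff contDiff_const
  · simp only [Matrix.updateRow_ne h]; exact hM _ _

theorem SG.mulVec {n p q : ℕ} {M : (Fin n → ℝ) → Matrix (Fin p) (Fin q) ℝ}
    (hM : ∀ i j, SG (fun x => M x i j)) {f : (Fin n → ℝ) → (Fin q → ℝ)} (hf : SG f) :
    SG (fun x => (M x).mulVec (f x)) := by
  rw [sg_pi]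
  intro i
  simp only [Matrix.mulVec, dotProduct]
  exact SG.sum _ fun j => (hM i j).mul (sg_pi.1 hf j)

theorem sg_mvpoly {n : ℕ} (q : MvPolynomial (Fin n) ℝ) : SG (fun x => MvPolynomial.eval x q) := by
  apply sg_of_contDiff
  rw [contDiff_iff_contDiffAt]
  intro x
  exact (AnalyticOnNhd.eval_mvPolynomial q x (Set.mem_univ _)).contDiffAt

theorem sg_eval {k n p : ℕ} (z : JetSpace k n p) : SG z.eval :=
  sg_pi.2 fun _ => sg_mvpoly _

@[simp] theorem eval_zero' {k n p : ℕ} (z : JetSpace k n p) : z.eval 0 = 0 := by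
  funext j
  have := (z.2 j).2
  simpa [JetSpace.eval, MvPolynomial.constantCoeff_eq, MvPolynomial.eval_zero] using this

/-- bounded matrices preserve little o -/
theorem mulVec_littleO {n p q : ℕ} {M : (Fin n → ℝ) → Matrix (Fin p) (Fin q) ℝ}
    (hM : ∀ i j, SG (fun x => M x i j)) {v : (Fin n → ℝ) → (Fin q → ℝ)} {g : (Fin n → ℝ) → ℝ}
    (hv : v =o[𝓝 0] g) : (fun x => (M x).mulVec (v x)) =o[𝓝 0] g := by
  rw [isLittleO_pi] at hv ⊢
  intro i
  simp only [Matrix.mulVec, dotProduct]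
  refine IsLittleO.fun_sum fun j _ => ?_
  have h1 : (fun x => M x i j) =O[𝓝 0] (fun _ => (1 : ℝ)) := (hM i j).cont.isBigO_one ℝ
  simpa using h1.mul_isLittleO (hv j)

theorem bigO_self {n m : ℕ} {h : (Fin n → ℝ) → (Fin m → ℝ)} (hh : DifferentiableAt ℝ h 0)
    (h0 : h 0 = 0) : h =O[𝓝 0] (fun x => x) := by
  simpa [h0] using hh.isBigO_sub

theorem comp_littleO {n m k : ℕ} {F : Type} [NormedAddCommGroup F]
    {h : (Fin n → ℝ) → (Fin m → ℝ)} (hh : SG h) (h0 : h 0 = 0)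
    {v : (Fin m → ℝ) → F} (hv : v =o[𝓝 0] fun x => ‖x‖ ^ k) :
    (fun x => v (h x)) =o[𝓝 0] fun x => ‖x‖ ^ k := by
  have ht : Tendsto h (𝓝 0) (𝓝 0) := by simpa [h0, ContinuousAt] using hh.cont
  exact (hv.comp_tendsto ht).trans_isBigO ((bigO_self hh.diff h0).norm_norm.pow k)

/-- working form of contact equivalence -/
def KE {k n p : ℕ} (z w : JetSpace k n p) : Prop :=
  ∃ (h : (Fin n → ℝ) → Fin n → ℝ) (M : (Fin n → ℝ) → Matrix (Fin p) (Fin p) ℝ),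
    h 0 = 0 ∧ SG h ∧ Function.Injective (fderiv ℝ h 0) ∧ (∀ i j, SG (fun x => M x i j)) ∧
    IsUnit (M 0) ∧
    (fun x => w.eval x - (M x).mulVec (z.eval (h x))) =o[𝓝 0] fun x => ‖x‖ ^ k

theorem kequiv_iff {k n p : ℕ} (z w : JetSpace k n p) : KEquiv z w ↔ KE z w := by
  constructor
  · rintro ⟨f, g, hf, hg, f0, g0, hzf, hwg, h, M, ⟨h0, hh, hb⟩, hM, hM0, he⟩
    have hh' := (sg_iff _).1 hh
    have hM' : ∀ i j, SG (fun x => M x i j) := by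
      have := (sg_iff _).1 hM
      intro i j
      filter_upwards [this] with x hx
      exact contDiffAt_pi.1 (contDiffAt_pi.1 hx i) j
    refine ⟨h, M, h0, hh', hb.1, hM', hM0, ?_⟩
    have h1 := mulVec_littleO hM' (comp_littleO hh' h0 hzf)
    refine (h1.sub hwg).congr' ?_ EventuallyEq.rfl
    filter_upwards [he] with x hx
    rw [hx, Matrix.mulVec_sub]
    abel
  · rintro ⟨h, M, h0, hh, hb, hM, hM0, he⟩
    refine ⟨z.eval, fun x => (M x).mulVec (z.eval (h x)), (sg_iff _).2 (sg_eval z),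
      (sg_iff _).2 (SG.mulVec hM ((sg_eval z).comp hh h0)), eval_zero' z, by simp [h0], ?_, ?_,
      h, M, ⟨h0, (sg_iff _).2 hh, hb, ?_⟩, (sg_iff _).2 ?_, hM0, Eventually.of_forall fun _ => rfl⟩
    · simp [IsJetAt]
    · refine he.neg_left.congr_left fun x => ?_
      simp
    · exact LinearMap.injective_iff_surjective (f := (fderiv ℝ h 0).toLinearMap) |>.1 hb
    · have : ∀ i, SG (fun x j => M x i j) := fun i => sg_pi.2 (hM i)
      have h2 := eventually_all.2 this
      filter_upwards [h2] with x hx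
      exact contDiffAt_pi.2 hx

theorem KE.trans {k n p : ℕ} {z w v : JetSpace k n p} (h1 : KE z w) (h2 : KE w v) : KE z v := by
  obtain ⟨h, M, h0, hh, hb, hM, hM0, he⟩ := h1
  obtain ⟨h', M', h0', hh', hb', hM', hM0', he'⟩ := h2
  refine ⟨fun x => h (h' x), fun x => M' x * M (h' x), by simp [h0, h0'], hh.comp hh' h0', ?_,
    ?_, ?_, ?_⟩
  · have hd : DifferentiableAt ℝ h (h' 0) := by rw [h0']; exact hh.diff
    have : fderiv ℝ (fun x => h (h' x)) 0 = (fderiv ℝ h (h' 0)).comp (fderiv ℝ h' 0) :=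
      fderiv_comp 0 hd hh'.diff
    rw [this, h0']
    exact hb.comp hb'
  · intro i j
    simp only [Matrix.mul_apply]
    exact SG.sum _ fun l => (hM' i l).mul ((hM l j).comp hh' h0')
  · simp only [h0']
    exact hM0'.mul hM0
  · refine (he'.add (mulVec_littleO hM' (comp_littleO hh' h0' he))).congr_left fun x => ?_
    simp only [Matrix.mulVec_sub, Matrix.mulVec_mulVec]
    abel

theorem exists_inverse_germ {n : ℕ} {h : (Fin n → ℝ) → Fin n → ℝ} (h0 : h 0 = 0) (hh : SG h)
    (hb : Function.Injective (fderiv ℝ h 0)) :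
    ∃ g : (Fin n → ℝ) → Fin n → ℝ, g 0 = 0 ∧ SG g ∧ Function.Injective (fderiv ℝ g 0) ∧
      ∀ᶠ x in 𝓝 0, h (g x) = x := by
  let f' : (Fin n → ℝ) ≃L[ℝ] (Fin n → ℝ) :=
    (LinearEquiv.ofInjectiveEndo (fderiv ℝ h 0).toLinearMap hb).toContinuousLinearEquiv
  have hf' : HasFDerivAt h (f' : (Fin n → ℝ) →L[ℝ] (Fin n → ℝ)) 0 := by
    have : (f' : (Fin n → ℝ) →L[ℝ] (Fin n → ℝ)) = fderiv ℝ h 0 := by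
      ext1 x; rfl
    rw [this]; exact hh.diff.hasFDerivAt
  let e := hh.at0.toOpenPartialHomeomorph h hf' (by simp)
  have he : ∀ x, e x = h x := fun x => rfl
  have hs : (0 : Fin n → ℝ) ∈ e.source := hh.at0.mem_toOpenPartialHomeomorph_source hf' (by simp)
  have ht : (0 : Fin n → ℝ) ∈ e.target := by
    have := e.map_source hs
    rwa [he, h0] at this
  have g0 : e.symm 0 = 0 := by
    have := e.left_inv hs
    rwa [he, h0] at this
  have hgh : ∀ᶠ x in 𝓝 0, h (e.symm x) = x := by
    filter_upwards [e.open_target.mem_nhds ht] with x hx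
    exact e.right_inv hx
  have hcont : Tendsto e.symm (𝓝 0) (𝓝 0) := by
    have := e.symm.continuousAt (x := 0) ht
    simpa [ContinuousAt, g0] using this
  have hinv : ∀ᶠ x in 𝓝 (0 : Fin n → ℝ), ∃ f'' : (Fin n → ℝ) ≃L[ℝ] (Fin n → ℝ),
      (f'' : (Fin n → ℝ) →L[ℝ] (Fin n → ℝ)) = fderiv ℝ h x := by
    have hc : ContinuousAt (fderiv ℝ h) 0 := by
      have := hh.at0.fderiv_right (m := 0) (by simp)
      exact this.continuousAt
    have hf0 : fderiv ℝ h 0 = f' := hf'.fderiv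
    have hn := ContinuousLinearEquiv.nhds f'
    rw [← hf0] at hn
    filter_upwards [hc hn] with x hx
    exact hx
  have hsg : SG e.symm := by
    filter_upwards [hcont.eventually hinv, hcont.eventually hh, e.open_target.mem_nhds ht]
      with x ⟨f'', h1⟩ h2 h3
    refine e.contDiffAt_symm (f₀' := f'') h3 ?_ h2
    rw [h1]
    exact (h2.differentiableAt (by simp)).hasFDerivAt
  refine ⟨e.symm, g0, hsg, ?_, hgh⟩
  have hd : DifferentiableAt ℝ h (e.symm 0) := by rw [g0]; exact hh.diff
  have h1 : fderiv ℝ (fun x => h (e.symm x)) 0 = (fderiv ℝ h (e.symm 0)).comp (fderiv ℝ e.symm 0) :=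
    fderiv_comp 0 hd hsg.diff
  have h2 : fderiv ℝ (fun x => h (e.symm x)) 0 = ContinuousLinearMap.id ℝ _ := by
    rw [Filter.EventuallyEq.fderiv_eq (f := fun x => x) hgh]
    exact fderiv_fun_id
  intro a b hab
  have h3 := congrArg (fun T => T a) (h1.symm.trans h2)
  have h4 := congrArg (fun T => T b) (h1.symm.trans h2)
  simp only [ContinuousLinearMap.comp_apply, ContinuousLinearMap.id_apply] at h3 h4
  rw [← h3, ← h4, hab]

theorem KE.symm {k n p : ℕ} {z w : JetSpace k n p} (h1 : KE z w) : KE w z := by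
  obtain ⟨h, M, h0, hh, hb, hM, hM0, he⟩ := h1
  obtain ⟨g, g0, hg, hgb, hhg⟩ := exists_inverse_germ h0 hh hb
  have hN : ∀ i j, SG (fun x => (M (g x))⁻¹ i j) := fun i j => (SG.matinv hM hM0 i j).comp hg g0
  have hu : IsUnit ((M 0)⁻¹) := by
    rw [Matrix.isUnit_nonsing_inv_iff]; exact hM0
  refine ⟨g, fun x => (M (g x))⁻¹, g0, hg, hgb, hN, by simpa [g0] using hu, ?_⟩
  have h2 := mulVec_littleO hN (comp_littleO hg g0 he)
  refine h2.neg_left.congr' ?_ EventuallyEq.rfl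
  have hdet : ∀ᶠ x in 𝓝 0, (M (g x)).det ≠ 0 := by
    have h3 : SG (fun x => (M (g x)).det) := (SG.det hM).comp hg g0
    have h4 : (M (g 0)).det ≠ 0 := by
      rw [g0]; exact ((Matrix.isUnit_iff_isUnit_det _).1 hM0).ne_zero
    exact h3.cont.eventually_ne h4
  filter_upwards [hhg, hdet] with x hx hd
  simp only [hx, Matrix.mulVec_sub, Matrix.mulVec_mulVec, neg_sub]
  rw [Matrix.nonsing_inv_mul _ (Ne.isUnit hd), Matrix.one_mulVec]

theorem eval_iPlusOne {k n p : ℕ} (hk : 1 ≤ k) (z : JetSpace k n p) (x : Fin (n + 1) → ℝ) :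
    (iPlusOne hk z).eval x = Fin.snoc (α := fun _ => ℝ) (z.eval (Fin.init x)) (x (Fin.last n)) := by
  funext j
  refine Fin.lastCases ?_ (fun j => ?_) j
  · simp [JetSpace.eval, iPlusOne]
  · simp [JetSpace.eval, iPlusOne, MvPolynomial.eval_rename]
    rfl

/-- `init` as a continuous linear map -/
noncomputable def initL (n : ℕ) : (Fin (n + 1) → ℝ) →L[ℝ] (Fin n → ℝ) :=
  ContinuousLinearMap.pi fun i => ContinuousLinearMap.proj (Fin.castSucc i)

theorem initL_apply {n : ℕ} (x : Fin (n + 1) → ℝ) : initL n x = Fin.init x := rfl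

/-- `x ↦ (x,0)` as a continuous linear map -/
noncomputable def extL (n : ℕ) : (Fin n → ℝ) →L[ℝ] (Fin (n + 1) → ℝ) :=
  ContinuousLinearMap.pi fun i => Fin.lastCases (motive := fun _ => (Fin n → ℝ) →L[ℝ] ℝ) 0
    (fun i => ContinuousLinearMap.proj i) i

@[simp] theorem extL_castSucc {n : ℕ} (x : Fin n → ℝ) (i : Fin n) :
    extL n x (Fin.castSucc i) = x i := by simp [extL]

@[simp] theorem extL_last {n : ℕ} (x : Fin n → ℝ) : extL n x (Fin.last n) = 0 := by simp [extL]

@[simp] theorem init_extL {n : ℕ} (x : Fin n → ℝ) : Fin.init (extL n x) = x := by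
  funext i; simp [Fin.init]

theorem fderiv_iPlusOne {k n p : ℕ} (hk : 1 ≤ k) (z : JetSpace k n p) (V : Fin (n + 1) → ℝ) :
    fderiv ℝ (iPlusOne hk z).eval 0 V =
      Fin.snoc (α := fun _ => ℝ) (fderiv ℝ z.eval 0 (Fin.init V)) (V (Fin.last n)) := by
  have h1 := (sg_eval (iPlusOne hk z)).diff.hasFDerivAt
  have hz := (sg_eval z).diff.hasFDerivAt
  have h2 := fun j => hasFDerivAt_pi'.1 h1 j
  simp only [eval_iPlusOne] at h2
  funext j
  refine Fin.lastCases ?_ (fun j => ?_) j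
  · have h3 := h2 (Fin.last p)
    simp only [Fin.snoc_last] at h3
    have h4 : HasFDerivAt (fun x : Fin (n + 1) → ℝ => x (Fin.last n))
      (ContinuousLinearMap.proj (R := ℝ) (φ := fun _ => ℝ) (Fin.last n)) 0 :=
        (ContinuousLinearMap.proj (R := ℝ) (φ := fun _ : Fin (n+1) => ℝ) (Fin.last n)).hasFDerivAt
    have h5 := congrArg (fun T => T V) (h3.unique h4)
    simpa using h5
  · have h3 := h2 (Fin.castSucc j)
    simp only [Fin.snoc_castSucc] at h3
    have h6 : HasFDerivAt z.eval (fderiv ℝ z.eval 0) (initL n 0) := by simpa using hz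
    have h4 := hasFDerivAt_pi'.1 (h6.comp (0 : Fin (n+1) → ℝ) (initL n).hasFDerivAt) j
    have h5 := congrArg (fun T => T V) (h3.unique h4)
    simpa [initL_apply] using h5

theorem hasFDerivAt_mulVec {n p q : ℕ} {M : (Fin n → ℝ) → Matrix (Fin p) (Fin q) ℝ}
    (hM : ∀ i j, SG (fun x => M x i j)) {f : (Fin n → ℝ) → (Fin q → ℝ)}
    {f' : (Fin n → ℝ) →L[ℝ] (Fin q → ℝ)} (hf : HasFDerivAt f f' 0) (f0 : f 0 = 0) :
    HasFDerivAt (fun x => (M x).mulVec (f x))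
      ((Matrix.mulVecLin (M 0)).toContinuousLinearMap.comp f') 0 := by
  rw [hasFDerivAt_pi']
  intro i
  simp only [Matrix.mulVec, dotProduct]
  have h1 : ∀ j, HasFDerivAt (fun x => M x i j * f x j)
      (M 0 i j • ((ContinuousLinearMap.proj (R := ℝ) (φ := fun _ => ℝ) j).comp f')) 0 := by
    intro j
    have := (hM i j).diff.hasFDerivAt.mul (hasFDerivAt_pi'.1 hf j)
    simpa [f0] using! this
  have h2 := HasFDerivAt.fun_sum (u := Finset.univ) fun j _ => h1 j
  convert! h2 using 1
  ext V
  simp [Matrix.mulVec, dotProduct]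

theorem isLittleO_id_of_pow {n k : ℕ} (hk : 1 ≤ k) {F : Type} [NormedAddCommGroup F]
    {v : (Fin n → ℝ) → F} (hv : v =o[𝓝 0] fun x => ‖x‖ ^ k) : v =o[𝓝 0] fun x => x := by
  refine hv.trans_isBigO ?_
  obtain ⟨m, rfl⟩ := Nat.exists_eq_add_of_le hk
  rw [← isBigO_norm_right]
  have h1 : (fun x : Fin n → ℝ => ‖x‖ ^ m) =O[𝓝 0] (fun _ => (1 : ℝ)) :=
    Filter.Tendsto.isBigO_one ℝ (Continuous.tendsto (by fun_prop) 0)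
  have := (isBigO_refl (fun x : Fin n → ℝ => ‖x‖) (𝓝 0)).mul h1
  simpa [pow_add] using this

theorem ke_deriv {k n p : ℕ} (hk : 1 ≤ k) {z w : JetSpace k n p}
    {h : (Fin n → ℝ) → Fin n → ℝ} {M : (Fin n → ℝ) → Matrix (Fin p) (Fin p) ℝ}
    (h0 : h 0 = 0) (hh : SG h) (hM : ∀ i j, SG (fun x => M x i j))
    (he : (fun x => w.eval x - (M x).mulVec (z.eval (h x))) =o[𝓝 0] fun x => ‖x‖ ^ k)
    (v : Fin n → ℝ) :
    fderiv ℝ w.eval 0 v = (M 0).mulVec (fderiv ℝ z.eval 0 (fderiv ℝ h 0 v)) := by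
  have hz : HasFDerivAt z.eval (fderiv ℝ z.eval 0) (h 0) := by
    rw [h0]; exact (sg_eval z).diff.hasFDerivAt
  have h1 := hasFDerivAt_mulVec hM (hz.comp (0 : Fin n → ℝ) hh.diff.hasFDerivAt) (by simp [h0])
  have h2 := (sg_eval w).diff.hasFDerivAt.sub h1
  have h3 : HasFDerivAt (fun x => w.eval x - (M x).mulVec (z.eval (h x))) 
      (0 : (Fin n → ℝ) →L[ℝ] (Fin p → ℝ)) 0 := by
    rw [hasFDerivAt_iff_isLittleO]
    simpa [h0] using isLittleO_id_of_pow hk he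
  have h4 := congrArg (fun T => T v) (h2.unique h3)
  simpa [sub_eq_zero] using h4

theorem isUnit_of_inj {p : ℕ} {A : Matrix (Fin p) (Fin p) ℝ} (h : ∀ v, A.mulVec v = 0 → v = 0) :
    IsUnit A := by
  rw [← Matrix.mulVec_injective_iff_isUnit]
  intro a b hab
  have := h (a - b) (by rw [Matrix.mulVec_sub]; exact sub_eq_zero.2 hab)
  exact sub_eq_zero.1 this

theorem inj_of_isUnit {p : ℕ} {A : Matrix (Fin p) (Fin p) ℝ} (h : IsUnit A) {v : Fin p → ℝ}
    (hv : A.mulVec v = 0) : v = 0 := by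
  apply Matrix.mulVec_injective_iff_isUnit.2 h
  simpa using hv

theorem cancel_core {k n p : ℕ} (hk : 1 ≤ k) {z z' : JetSpace k n p}
    {h : (Fin (n + 1) → ℝ) → Fin (n + 1) → ℝ}
    {M : (Fin (n + 1) → ℝ) → Matrix (Fin (p + 1)) (Fin (p + 1)) ℝ}
    (h0 : h 0 = 0) (hh : SG h) (hb : Function.Injective (fderiv ℝ h 0))
    (hM : ∀ i j, SG (fun x => M x i j)) (hM0 : IsUnit (M 0))
    (he : (fun x => (iPlusOne hk z').eval x - (M x).mulVec ((iPlusOne hk z).eval (h x)))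
      =o[𝓝 0] fun x => ‖x‖ ^ k)
    (hs : M 0 (Fin.last p) (Fin.last p) ≠ 0) : KE z z' := by
  have hext : SG (extL n : (Fin n → ℝ) → (Fin (n + 1) → ℝ)) := sg_of_contDiff (extL n).contDiff
  have hN : ∀ i j, SG (fun x => M (extL n x) i j) := fun i j => (hM i j).comp hext (by simp)
  have hs' : M (extL n 0) (Fin.last p) (Fin.last p) ≠ 0 := by simpa using hs
  have hhe : SG (fun x => h (extL n x)) := hh.comp hext (by simp)
  refine ⟨fun x => initL n (h (extL n x)),
    fun x => Matrix.of fun i j => M (extL n x) (Fin.castSucc i) (Fin.castSucc j) -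
      M (extL n x) (Fin.castSucc i) (Fin.last p) * ((M (extL n x) (Fin.last p) (Fin.last p))⁻¹ *
        M (extL n x) (Fin.last p) (Fin.castSucc j)), by simp [h0], ?_, ?_, ?_, ?_, ?_⟩
  · filter_upwards [hhe] with x hx
    exact (initL n).contDiff.contDiffAt.comp x hx
  · have hd : HasFDerivAt h (fderiv ℝ h 0) (extL n 0) := by simpa using hh.diff.hasFDerivAt
    have hd' := (initL n).hasFDerivAt.comp (0 : Fin n → ℝ)
      (hd.comp (0 : Fin n → ℝ) (extL n).hasFDerivAt)
    have hd2 : fderiv ℝ (fun x => initL n (h (extL n x))) 0 = _ := hd'.fderiv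
    rw [hd2]
    rw [injective_iff_map_eq_zero]
    intro v hv
    have h3 := ke_deriv hk h0 hh hM he (extL n v)
    have hv' : Fin.init (fderiv ℝ h 0 (extL n v)) = 0 := hv
    rw [fderiv_iPlusOne, fderiv_iPlusOne, hv'] at h3
    have h4 := congrFun h3 (Fin.last p)
    simp [Matrix.mulVec, dotProduct, Fin.sum_univ_castSucc, hs] at h4
    have h5 : fderiv ℝ h 0 (extL n v) = 0 := by
      funext i
      refine Fin.lastCases h4 (fun i => ?_) i
      exact congrFun hv' i
    have h6 : extL n v = 0 := (injective_iff_map_eq_zero _).1 hb _ h5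
    funext i
    have := congrFun h6 (Fin.castSucc i)
    simpa using this
  · intro i j
    exact (hN _ _).sub ((hN _ _).mul (((hN _ _).inv hs').mul (hN _ _)))
  · apply isUnit_of_inj
    intro v hv
    simp only [map_zero] at hv
    have : (Fin.snoc (α := fun _ => ℝ) v (-((M 0 (Fin.last p) (Fin.last p))⁻¹ *
        ∑ j, M 0 (Fin.last p) (Fin.castSucc j) * v j)) : Fin (p + 1) → ℝ) = 0 := by
      apply inj_of_isUnit hM0
      funext i
      refine Fin.lastCases ?_ (fun i => ?_) i
      · simp [Matrix.mulVec, dotProduct, Fin.sum_univ_castSucc]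
        field_simp
        simp
      · have := congrFun hv i
        simp [Matrix.mulVec, dotProduct, Fin.sum_univ_castSucc, sub_mul, Finset.mul_sum,
          mul_assoc] at this ⊢
        linarith
    funext i
    have h7 := congrFun this (Fin.castSucc i)
    simpa using h7
  · have h1 := comp_littleO hext (by simp) he
    have hP : ∀ (i : Fin p) (j : Fin (p + 1)), SG (fun x => (Matrix.of fun (i : Fin p) j =>
      (if j = Fin.castSucc i then (1 : ℝ) else 0) - (if j = Fin.last p then
        M (extL n x) (Fin.castSucc i) (Fin.last p) *
          (M (extL n x) (Fin.last p) (Fin.last p))⁻¹ else 0) : Matrix (Fin p) (Fin (p+1)) ℝ) i j) := by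
      intro i j
      simp only [Matrix.of_apply]
      refine (sg_of_contDiff contDiff_const).sub ?_
      split_ifs
      · exact (hN _ _).mul ((hN _ _).inv hs')
      · exact sg_of_contDiff contDiff_const
    refine (mulVec_littleO hP h1).congr' ?_ EventuallyEq.rfl
    filter_upwards [(hN (Fin.last p) (Fin.last p)).cont.eventually_ne hs'] with x hx
    funext i
    simp only [eval_iPlusOne]
    simp [Matrix.mulVec, dotProduct, Fin.sum_univ_castSucc, sub_mul, Finset.sum_sub_distrib,
      initL_apply, mul_assoc]
    have e2 : ∀ c : ℝ, (M (extL n x) (Fin.last p) (Fin.last p))⁻¹ * 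
      (M (extL n x) (Fin.last p) (Fin.last p) * c) = c := fun c => by field_simp
    simp [mul_add, e2, mul_neg, Finset.mul_sum]
    ring

/-- `q` is congruent to `q` with substituted variables, modulo an ideal. -/
theorem aeval_sub_mem {n : ℕ} {A : Type} [CommRing A] [Algebra ℝ A] (J : Ideal A)
    (f g : Fin n → A) (h : ∀ i, f i - g i ∈ J) (q : MvPolynomial (Fin n) ℝ) :
    MvPolynomial.aeval f q - MvPolynomial.aeval g q ∈ J := by
  rw [← Ideal.Quotient.mk_eq_mk_iff_sub_mem]
  have : (Ideal.Quotient.mkₐ ℝ J).comp (MvPolynomial.aeval f) =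
      (Ideal.Quotient.mkₐ ℝ J).comp (MvPolynomial.aeval g) := by
    ext i
    simp only [AlgHom.comp_apply, MvPolynomial.aeval_X, Ideal.Quotient.mkₐ_eq_mk]
    exact (Ideal.Quotient.mk_eq_mk_iff_sub_mem _ _).2 (h i)
  exact congrArg (fun T => T q) this

/-- the matrix `1 - (last column Q)` -/
noncomputable def shear {p : ℕ} {R : Type} [CommRing R] (Q : Fin p → R) :
    Matrix (Fin (p + 1)) (Fin (p + 1)) R :=
  Matrix.of fun i j => (if i = j then 1 else 0) -
    (if j = Fin.last p then Fin.snoc (α := fun _ => R) Q 0 i else 0)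

theorem shear_mulVec {p : ℕ} {R : Type} [CommRing R] (Q : Fin p → R) (V : Fin (p + 1) → R) :
    (shear Q).mulVec V = fun i => V i - Fin.snoc (α := fun _ => R) Q 0 i * V (Fin.last p) := by
  funext i
  simp [shear, Matrix.mulVec, dotProduct, sub_mul, Finset.sum_sub_distrib]

theorem shear_isUnit {p : ℕ} (Q : Fin p → ℝ) : IsUnit (shear Q) := by
  apply isUnit_of_inj
  intro v hv
  rw [shear_mulVec] at hv
  have h1 := congrFun hv (Fin.last p)
  simp at h1
  funext i
  have h2 := congrFun hv i
  simpa [h1] using h2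

theorem cancel {k n p : ℕ} (hk : 1 ≤ k) {z z' : JetSpace k n p}
    (H : KE (iPlusOne hk z) (iPlusOne hk z')) : KE z z' := by
  obtain ⟨h, M, h0, hh, hb, hM, hM0, he⟩ := H
  have key : ∃ v : Fin n → ℝ, M 0 (Fin.last p) (Fin.last p) -
      ∑ j, M 0 (Fin.last p) (Fin.castSucc j) * fderiv ℝ z.eval 0 v j ≠ 0 := by
    by_cases hs : M 0 (Fin.last p) (Fin.last p) = 0
    · refine ⟨Fin.init (fderiv ℝ h 0 (Pi.single (Fin.last n) 1)), ?_⟩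
      have h1 := congrFun (ke_deriv hk h0 hh hM he (Pi.single (Fin.last n) 1)) (Fin.last p)
      rw [fderiv_iPlusOne, fderiv_iPlusOne] at h1
      simp [Matrix.mulVec, dotProduct, Fin.sum_univ_castSucc, hs] at h1
      rw [hs, ← h1]
      norm_num
    · exact ⟨0, by simpa using hs⟩
  obtain ⟨v, hv⟩ := key
  have hdiv : ∀ j, ∃ q : MvPolynomial (Fin (n + 1)) ℝ, 
      MvPolynomial.aeval (fun i : Fin n => (MvPolynomial.X (Fin.castSucc i) : MvPolynomial (Fin (n + 1)) ℝ)
        + MvPolynomial.C (v i) * MvPolynomial.X (Fin.last n)) (z.1 j) -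
      MvPolynomial.aeval (fun i : Fin n => (MvPolynomial.X (Fin.castSucc i) : MvPolynomial (Fin (n + 1)) ℝ))
        (z.1 j) = MvPolynomial.X (Fin.last n) * q := by
    intro j
    have := aeval_sub_mem (Ideal.span {(MvPolynomial.X (Fin.last n) : MvPolynomial (Fin (n + 1)) ℝ)})
      (fun i : Fin n => (MvPolynomial.X (Fin.castSucc i) : MvPolynomial (Fin (n + 1)) ℝ)
        + MvPolynomial.C (v i) * MvPolynomial.X (Fin.last n))
      (fun i : Fin n => (MvPolynomial.X (Fin.castSucc i) : MvPolynomial (Fin (n + 1)) ℝ))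
      (fun i => by
        rw [Ideal.mem_span_singleton]; simp) (z.1 j)
    rw [Ideal.mem_span_singleton] at this
    exact this
  choose q hq using hdiv
  -- evaluated
  have hev : ∀ (x : Fin (n + 1) → ℝ) (j : Fin p),
      z.eval (fun i => x (Fin.castSucc i) + v i * x (Fin.last n)) j - z.eval (Fin.init x) j =
        x (Fin.last n) * MvPolynomial.eval x (q j) := by
    intro x j
    have := congrArg (MvPolynomial.eval x) (hq j)
    rw [map_sub, map_mul, MvPolynomial.eval_X] at this
    rw [← this]
    have e : ∀ f : Fin n → MvPolynomial (Fin (n + 1)) ℝ,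
        MvPolynomial.eval x (MvPolynomial.aeval f (z.1 j)) =
          MvPolynomial.eval (fun i => MvPolynomial.eval x (f i)) (z.1 j) := by
      intro f
      rw [← MvPolynomial.coe_aeval_eq_eval, ← MvPolynomial.coe_aeval_eq_eval]
      simp only [RingHom.coe_coe]
      rw [← AlgHom.comp_apply, MvPolynomial.comp_aeval]
    rw [e, e]
    simp [JetSpace.eval]
    rfl
  have hq0 : ∀ j, MvPolynomial.eval 0 (q j) = fderiv ℝ z.eval 0 v j := by
    intro j
    let e : Fin (n + 1) → ℝ := Pi.single (Fin.last n) 1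
    have h1 : HasFDerivAt (fun x : Fin (n + 1) → ℝ =>
        x (Fin.last n) * MvPolynomial.eval x (q j)) _ 0 :=
      (ContinuousLinearMap.proj (R := ℝ) (φ := fun _ : Fin (n+1) => ℝ) (Fin.last n)).hasFDerivAt.mul
        (sg_mvpoly (q j)).diff.hasFDerivAt
    let T : (Fin (n + 1) → ℝ) →L[ℝ] (Fin n → ℝ) := initL n + 
      (ContinuousLinearMap.proj (R := ℝ) (φ := fun _ : Fin (n+1) => ℝ) (Fin.last n)).smulRight v
    have hT : ∀ x, T x = fun i => x (Fin.castSucc i) + v i * x (Fin.last n) := by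
      intro x; funext i; simp [T, initL, mul_comm]
    have hz := hasFDerivAt_pi'.1 (sg_eval z).diff.hasFDerivAt j
    have h2 : HasFDerivAt (fun x : Fin (n + 1) → ℝ => z.eval (T x) j - z.eval (initL n x) j)
        _ 0 := 
      (HasFDerivAt.comp (0 : Fin (n + 1) → ℝ) (by simpa using hz) T.hasFDerivAt).sub 
        (HasFDerivAt.comp (0 : Fin (n + 1) → ℝ) (by simpa using hz) (initL n).hasFDerivAt)
    simp only [hT, initL_apply, hev] at h2
    have h3 := congrArg (fun S => S e) (h1.unique h2)
    have hi : initL n e = 0 := by funext i; simp [initL, e]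
    have hTe : T e = v := by
      rw [hT]; funext i; simp [e]
    simpa [hi, hTe, e] using h3
  let τ : (Fin (n + 1) → ℝ) →L[ℝ] (Fin (n + 1) → ℝ) := ContinuousLinearMap.id ℝ _ +
      (ContinuousLinearMap.proj (R := ℝ) (φ := fun _ : Fin (n+1) => ℝ) (Fin.last n)).smulRight 
        (extL n v)
  have hτc : ∀ x i, τ x (Fin.castSucc i) = x (Fin.castSucc i) + v i * x (Fin.last n) := by
    intro x i; simp [τ, mul_comm]
  have hτl : ∀ x, τ x (Fin.last n) = x (Fin.last n) := by
    intro x; simp [τ]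
  have hτ : SG (τ : (Fin (n + 1) → ℝ) → (Fin (n + 1) → ℝ)) := sg_of_contDiff τ.contDiff
  let S : (Fin (n + 1) → ℝ) → Matrix (Fin (p + 1)) (Fin (p + 1)) ℝ := fun x =>
    shear fun j => MvPolynomial.eval x (q j)
  have hS : ∀ i j, SG (fun x => S x i j) := by
    intro i j
    simp only [S, shear, Matrix.of_apply]
    refine (sg_of_contDiff contDiff_const).sub ?_
    split_ifs
    · refine Fin.lastCases ?_ (fun i => ?_) i
      · simp only [Fin.snoc_last]; exact sg_of_contDiff contDiff_const
      · simp only [Fin.snoc_castSucc]; exact sg_mvpoly _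
    · exact sg_of_contDiff contDiff_const
  have hST : ∀ x, (S x).mulVec ((iPlusOne hk z).eval (τ x)) = (iPlusOne hk z).eval x := by
    intro x
    rw [eval_iPlusOne, eval_iPlusOne, shear_mulVec]
    funext i
    refine Fin.lastCases ?_ (fun i => ?_) i
    · simp [hτl]
    · have := hev x i
      have e2 : Fin.init (τ x) = (fun i => x (Fin.castSucc i) + v i * x (Fin.last n)) := by
        funext i; exact hτc x i
      simp only [Fin.snoc_castSucc, Fin.snoc_last, e2, hτl]
      linarith
  refine cancel_core (h := fun x => τ (h x)) (M := fun x => M x * S (h x)) hk (by simp [h0])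
    (hτ.comp hh h0) ?_ ?_ ?_ ?_ ?_
  · have : fderiv ℝ (fun x => τ (h x)) 0 = τ.comp (fderiv ℝ h 0) :=
      (τ.hasFDerivAt.comp (0 : Fin (n + 1) → ℝ) hh.diff.hasFDerivAt).fderiv
    rw [this]
    suffices hti : Function.Injective τ from hti.comp hb
    rw [injective_iff_map_eq_zero]
    intro x hx
    have h1 : x (Fin.last n) = 0 := by rw [← hτl x, hx]; rfl
    funext i
    refine Fin.lastCases h1 (fun i => ?_) i
    have := hτc x i
    rw [hx, h1] at this
    simpa using this.symm
  · intro i j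
    simp only [Matrix.mul_apply]
    exact SG.sum _ fun l => (hM i l).mul ((hS l j).comp hh h0)
  · exact hM0.mul (shear_isUnit _)
  · refine he.congr_left fun x => ?_
    rw [← Matrix.mulVec_mulVec, hST]
  · simp only [h0]
    have : (M 0 * S 0) (Fin.last p) (Fin.last p) = M 0 (Fin.last p) (Fin.last p) -
      ∑ j, M 0 (Fin.last p) (Fin.castSucc j) * fderiv ℝ z.eval 0 v j := by
      have hq0' : ∀ j, MvPolynomial.constantCoeff (q j) = fderiv ℝ z.eval 0 v j := by
        intro j
        have := hq0 j
        rwa [MvPolynomial.eval_zero] at this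
      simp [Matrix.mul_apply, S, shear, Fin.sum_univ_castSucc, hq0', mul_sub]
    rw [this]
    exact hv

open MvPolynomial in
theorem eval_littleO {n r : ℕ} {q : MvPolynomial (Fin n) ℝ} (hq : q ∈ idealOfVars (Fin n) ℝ ^ (r + 1)) :
    (fun x => eval x q) =o[𝓝 (0 : Fin n → ℝ)] fun x => ‖x‖ ^ r := by
  have h1 : (fun x : Fin n → ℝ => ‖x‖ ^ (r + 1)) =o[𝓝 0] fun x => ‖x‖ ^ r := by
    have h2 : (fun x : Fin n → ℝ => ‖x‖) =o[𝓝 0] (fun _ => (1 : ℝ)) := by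
      rw [isLittleO_one_iff]
      simpa using (continuous_norm (E := Fin n → ℝ)).tendsto 0
    simpa [pow_succ] using (isBigO_refl (fun x : Fin n → ℝ => ‖x‖ ^ r) (𝓝 0)).mul_isLittleO h2
  refine IsBigO.trans_isLittleO ?_ h1
  simp only [eval_eq]
  refine IsBigO.fun_sum fun d hd => ?_
  have hdeg : r + 1 ≤ d.degree := (mem_pow_idealOfVars_iff _ _).1 hq d hd
  refine IsBigO.const_mul_left ?_ _
  have hball : ∀ᶠ x in 𝓝 (0 : Fin n → ℝ), ‖x‖ ≤ 1 := by
    filter_upwards [Metric.ball_mem_nhds (0 : Fin n → ℝ) one_pos] with x hx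
    simpa using (mem_ball_zero_iff.1 hx).le
  refine IsBigO.of_bound 1 ?_
  filter_upwards [hball] with x hx
  rw [one_mul, norm_prod, norm_pow, norm_norm]
  calc ∏ i ∈ d.support, ‖x i ^ d i‖ ≤ ∏ i ∈ d.support, ‖x‖ ^ d i := by
        refine Finset.prod_le_prod (fun _ _ => norm_nonneg _) fun i _ => ?_
        rw [norm_pow]
        exact pow_le_pow_left₀ (norm_nonneg _) (norm_le_pi_norm x i) _
    _ = ‖x‖ ^ d.degree := by rw [Finset.prod_pow_eq_pow_sum]; rfl
    _ ≤ ‖x‖ ^ (r + 1) := pow_le_pow_of_le_one (norm_nonneg _) hx hdeg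

theorem coeff_truncPoly (k : ℕ) {n : ℕ} (φ : MvPolynomial (Fin n) ℝ) (d : Fin n →₀ ℕ) :
    MvPolynomial.coeff d (truncPoly k φ) =
      if 1 ≤ d.degree ∧ d.degree ≤ k then MvPolynomial.coeff d φ else 0 := by
  classical
  rw [truncPoly, MvPolynomial.coeff_sum]
  simp only [MvPolynomial.coeff_monomial]
  rw [Finset.sum_ite_eq' ]
  simp only [Finset.mem_filter, MvPolynomial.mem_support_iff]
  have e : (d.sum fun _ e => e) = d.degree := rfl
  rw [e]
  split_ifs with h1 h2 h2
  · rfl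
  · exact absurd h1.2 h2
  · by_contra h3
    exact h1 ⟨fun h4 => h3 h4.symm, h2⟩
  · rfl

open MvPolynomial in
theorem sub_truncPoly_mem (k : ℕ) {n : ℕ} (φ : MvPolynomial (Fin n) ℝ)
    (h : constantCoeff φ = 0) : φ - truncPoly k φ ∈ idealOfVars (Fin n) ℝ ^ (k + 1) := by
  rw [mem_pow_idealOfVars_iff']
  intro d hd
  rw [coeff_sub, coeff_truncPoly]
  by_cases h1 : 1 ≤ d.degree
  · rw [if_pos ⟨h1, by omega⟩, sub_self]
  · have : d = 0 := by
      rw [← Finsupp.degree_eq_zero_iff]; omega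
    subst this
    simpa [constantCoeff_eq] using h

theorem degree_le_of_coeff_ne {k n p : ℕ} (w : JetSpace k n p) (j : Fin p) {d : Fin n →₀ ℕ}
    (hd : MvPolynomial.coeff d (w.1 j) ≠ 0) : 1 ≤ d.degree ∧ d.degree ≤ k := by
  constructor
  · by_contra h
    have : d = 0 := by
      rw [← Finsupp.degree_eq_zero_iff]; omega
    subst this
    exact hd (w.2 j).2
  · refine le_trans ?_ (w.2 j).1
    exact MvPolynomial.le_totalDegree (MvPolynomial.mem_support_iff.2 hd)

theorem truncPoly_jet {k n p : ℕ} (w : JetSpace k n p) (j : Fin p) :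
    truncPoly k (w.1 j) = w.1 j := by
  ext d
  rw [coeff_truncPoly]
  split_ifs with h
  · rfl
  · by_contra h1
    exact h (degree_le_of_coeff_ne w j (fun h2 => h1 h2.symm))

open MvPolynomial in
theorem eval_aeval' {n m : ℕ} (x : Fin m → ℝ) (f : Fin n → MvPolynomial (Fin m) ℝ)
    (q : MvPolynomial (Fin n) ℝ) :
    eval x (aeval f q) = eval (fun i => eval x (f i)) q := by
  rw [← coe_aeval_eq_eval, ← coe_aeval_eq_eval]
  simp only [RingHom.coe_coe]
  rw [← AlgHom.comp_apply, comp_aeval]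

open MvPolynomial in
theorem constantCoeff_aeval' {n m : ℕ} (f : Fin n → MvPolynomial (Fin m) ℝ)
    (hf : ∀ i, constantCoeff (f i) = 0)
    (q : MvPolynomial (Fin n) ℝ) :
    constantCoeff (aeval f q) = constantCoeff q := by
  have h1 := eval_aeval' 0 f q
  simp only [eval_zero, hf] at h1
  rw [h1]
  exact congrFun (congrArg _ eval_zero) q

open MvPolynomial in
/-- polynomial moves -/
theorem move {k n p : ℕ} (w : JetSpace k n p) (h : Fin n → MvPolynomial (Fin n) ℝ)
    (M : Matrix (Fin p) (Fin p) (MvPolynomial (Fin n) ℝ))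
    (h0 : ∀ i, constantCoeff (h i) = 0)
    (hb : Function.Injective (fderiv ℝ (fun (x : Fin n → ℝ) i => eval x (h i)) 0))
    (hM : IsUnit (Matrix.of fun i j => eval 0 (M i j))) :
    KE w (truncJet k n p fun j => ∑ i, M j i * aeval h (w.1 i)) := by
  refine ⟨_, fun x => Matrix.of fun i j => eval x (M i j), ?_, sg_pi.2 fun i => sg_mvpoly (h i), hb,
    fun i j => sg_mvpoly _, hM, ?_⟩
  · funext i
    simpa [eval_zero] using h0 i
  · rw [isLittleO_pi]
    intro j
    have h1 : constantCoeff (∑ i, M j i * aeval h (w.1 i)) = 0 := by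
      rw [map_sum]
      refine Finset.sum_eq_zero fun i _ => ?_
      rw [map_mul, constantCoeff_aeval' h h0, (w.2 i).2, mul_zero]
    have := (eval_littleO (sub_truncPoly_mem k _ h1)).neg_left
    refine this.congr_left fun x => ?_
    simp [JetSpace.eval, truncJet, Matrix.mulVec, dotProduct]
    exact Finset.sum_congr rfl fun i _ => by rw [← eval_aeval' x h]; rfl

/-- continuity of coefficients -/
def CC {X : Type} [TopologicalSpace X] {n : ℕ} (f : X → MvPolynomial (Fin n) ℝ) : Prop :=
  ∀ d, Continuous fun x => MvPolynomial.coeff d (f x)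

section CCs
variable {X : Type} [TopologicalSpace X] {n m : ℕ}

theorem cc_const (q : MvPolynomial (Fin n) ℝ) : CC (fun _ : X => q) := fun _ => continuous_const

theorem cc_C {c : X → ℝ} (hc : Continuous c) :
    CC (fun x => (MvPolynomial.C (c x) : MvPolynomial (Fin n) ℝ)) := by
  intro d
  simp only [MvPolynomial.coeff_C]
  split_ifs
  · exact hc
  · exact continuous_const

theorem CC.add {f g : X → MvPolynomial (Fin n) ℝ} (hf : CC f) (hg : CC g) :
    CC (fun x => f x + g x) := by
  intro d
  simp only [MvPolynomial.coeff_add]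
  exact (hf d).add (hg d)

theorem CC.sub {f g : X → MvPolynomial (Fin n) ℝ} (hf : CC f) (hg : CC g) :
    CC (fun x => f x - g x) := by
  intro d
  simp only [MvPolynomial.coeff_sub]
  exact (hf d).sub (hg d)

theorem CC.mul {f g : X → MvPolynomial (Fin n) ℝ} (hf : CC f) (hg : CC g) :
    CC (fun x => f x * g x) := by
  intro d
  simp only [MvPolynomial.coeff_mul]
  exact continuous_finsetSum _ fun e _ => (hf _).mul (hg _)

theorem CC.sum {ι : Type} (s : Finset ι) {f : ι → X → MvPolynomial (Fin n) ℝ}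
    (hf : ∀ i, CC (f i)) : CC (fun x => ∑ i ∈ s, f i x) := by
  intro d
  simp only [MvPolynomial.coeff_sum]
  exact continuous_finsetSum _ fun e _ => hf _ _

theorem CC.pow {f : X → MvPolynomial (Fin n) ℝ} (hf : CC f) (r : ℕ) : CC (fun x => f x ^ r) := by
  induction r with
  | zero => simpa using cc_const _
  | succ r ih => simpa [pow_succ] using ih.mul hf

theorem CC.prod {ι : Type} (s : Finset ι) {f : ι → X → MvPolynomial (Fin n) ℝ}
    (hf : ∀ i, CC (f i)) : CC (fun x => ∏ i ∈ s, f i x) := by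
  classical
  induction s using Finset.induction_on with
  | empty => simpa using cc_const _
  | insert a s ha ih => simpa [Finset.prod_insert ha] using (hf a).mul ih

theorem CC.trunc (k : ℕ) {f : X → MvPolynomial (Fin n) ℝ} (hf : CC f) :
    CC (fun x => truncPoly k (f x)) := by
  intro d
  simp only [coeff_truncPoly]
  split_ifs
  · exact hf d
  · exact continuous_const

theorem cont_iff_cc {k p : ℕ} {g : X → JetSpace k n p} :
    Continuous g ↔ ∀ j, CC (fun x => (g x).1 j) := by
  constructor
  · intro hg j d
    by_cases hd : ∀ i, d i ≤ k
    · have h1 : Continuous (fun z : JetSpace k n p => jetCoeffs z) := continuous_induced_dom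
      have h2 := ((continuous_apply (fun i => (⟨d i, Nat.lt_succ_of_le (hd i)⟩ : Fin (k + 1)))).comp
        ((continuous_apply j).comp (h1.comp hg)))
      convert! h2 using 2 with x
      simp only [Function.comp, jetCoeffs]
      congr 1
      ext i; rfl
    · have : ∀ x, MvPolynomial.coeff d ((g x).1 j) = 0 := by
        intro x
        by_contra hne
        apply hd
        intro i
        exact (Finsupp.le_degree i d).trans (degree_le_of_coeff_ne (g x) j hne).2
      simp only [this]
      exact continuous_const
  · intro h
    refine continuous_induced_rng.2 ?_
    refine continuous_pi fun j => continuous_pi fun e => h j _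

theorem cont_truncJet {k p : ℕ} {q : X → Fin p → MvPolynomial (Fin n) ℝ}
    (hq : ∀ j, CC (fun x => q x j)) : Continuous (fun x => truncJet k n p (q x)) :=
  cont_iff_cc.2 fun j => (hq j).trunc k

open MvPolynomial in
theorem aeval_jet_eq {k p : ℕ} (w : JetSpace k n p) (j : Fin p)
    (h : Fin n → MvPolynomial (Fin m) ℝ) :
    aeval h (w.1 j) = ∑ e : Fin n → Fin (k + 1), 
      C (coeff (Finsupp.equivFunOnFinite.symm fun i => (e i : ℕ)) (w.1 j)) *
        ∏ i, h i ^ (e i : ℕ) := by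
  classical
  rw [aeval_def, eval₂_eq']
  have hinj : Function.Injective (fun e : Fin n → Fin (k + 1) =>
      (Finsupp.equivFunOnFinite.symm fun i => (e i : ℕ) : Fin n →₀ ℕ)) := by
    intro a b hab
    funext i
    have := DFunLike.congr_fun hab i
    exact Fin.ext this
  rw [show (∑ e : Fin n → Fin (k + 1), 
      C (coeff (Finsupp.equivFunOnFinite.symm fun i => (e i : ℕ)) (w.1 j)) *
        ∏ i, h i ^ (e i : ℕ)) = ∑ d ∈ Finset.univ.image (fun e : Fin n → Fin (k + 1) =>
      (Finsupp.equivFunOnFinite.symm fun i => (e i : ℕ) : Fin n →₀ ℕ)), 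
        C (coeff d (w.1 j)) * ∏ i, h i ^ (d i) by
        rw [Finset.sum_image (fun a _ b _ hab => hinj hab)]; rfl]
  refine Finset.sum_subset ?_ ?_
  · intro d hd
    have hd' := degree_le_of_coeff_ne w j (mem_support_iff.1 hd)
    rw [Finset.mem_image]
    refine ⟨fun i => ⟨d i, Nat.lt_succ_of_le ((Finsupp.le_degree i d).trans hd'.2)⟩,
      Finset.mem_univ _, ?_⟩
    ext i; rfl
  · intro d _ hd
    rw [notMem_support_iff.1 hd]
    simp

theorem cc_aeval {k p : ℕ} {g : X → JetSpace k n p} (hg : Continuous g) (j : Fin p)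
    {h : X → Fin n → MvPolynomial (Fin m) ℝ} (hh : ∀ i, CC (fun x => h x i)) :
    CC (fun x => MvPolynomial.aeval (h x) ((g x).1 j)) := by
  simp only [aeval_jet_eq]
  exact CC.sum _ fun e => (cc_C (cont_iff_cc.1 hg j _)).mul (CC.prod _ fun i => (hh i).pow _)

end CCs

open MvPolynomial in
theorem fderiv_poly {n : ℕ} {μ : MvPolynomial (Fin n) ℝ} (h0 : constantCoeff μ = 0)
    (V : Fin n → ℝ) :
    fderiv ℝ (fun x : Fin n → ℝ => eval x μ) 0 V = ∑ i, coeff (Finsupp.single i 1) μ * V i := by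
  have hmem : μ - ∑ i, C (coeff (Finsupp.single i 1) μ) * X i ∈ idealOfVars (Fin n) ℝ ^ (1 + 1) := by
    rw [mem_pow_idealOfVars_iff']
    intro d hd
    rw [coeff_sub, coeff_sum]
    simp only [coeff_C_mul, coeff_X']
    by_cases h : d.degree = 0
    · rw [Finsupp.degree_eq_zero_iff] at h
      subst h
      simpa [constantCoeff_eq] using h0
    · have h1 : d.degree = 1 := by omega
      obtain ⟨i, rfl⟩ := (Finsupp.sum_eq_one_iff d).1 h1
      simp [Finsupp.single_left_inj]
  have h1 := eval_littleO hmem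
  have h2 : HasFDerivAt (fun x : Fin n → ℝ => eval x μ) (∑ i, coeff (Finsupp.single i 1) μ •
      ContinuousLinearMap.proj (R := ℝ) (φ := fun _ : Fin n => ℝ) i) 0 := by
    rw [hasFDerivAt_iff_isLittleO]
    have h3 := isLittleO_id_of_pow le_rfl h1
    have e0 : eval (0 : Fin n → ℝ) μ = 0 := by rw [eval_zero]; exact h0
    simp only [e0, sub_zero]
    refine h3.congr_left fun x => ?_
    simp
  rw [h2.fderiv]
  simp

theorem KE.refl {k n p : ℕ} (w : JetSpace k n p) : KE w w := by
  refine ⟨fun x => x, fun _ => 1, rfl, sg_of_contDiff contDiff_id, ?_,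
    fun i j => sg_of_contDiff contDiff_const, isUnit_one, ?_⟩
  · rw [fderiv_fun_id]; exact fun a b h => h
  · simp

open MvPolynomial in
theorem move_mat {k n p : ℕ} (w : JetSpace k n p)
    (M : Matrix (Fin p) (Fin p) (MvPolynomial (Fin n) ℝ))
    (hM : IsUnit (Matrix.of fun i j => eval 0 (M i j))) :
    KE w (truncJet k n p (M.mulVec w.1)) := by
  have := move w (fun i => X i) M (by simp) (by
    simp only [eval_X]
    rw [fderiv_fun_id]; exact fun a b h => h) hM
  simpa [aeval_X_left] using! this

open MvPolynomial in
theorem move_sub {k n p : ℕ} (w : JetSpace k n p) (h : Fin n → MvPolynomial (Fin n) ℝ)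
    (h0 : ∀ i, constantCoeff (h i) = 0)
    (hb : Function.Injective (fderiv ℝ (fun (x : Fin n → ℝ) i => eval x (h i)) 0)) :
    KE w (truncJet k n p fun j => aeval h (w.1 j)) := by
  have := move w h 1 h0 hb (by
    convert! isUnit_one
    ext i j
    by_cases hij : i = j <;> simp [Matrix.one_apply, hij])
  simpa [Matrix.one_apply] using! this

/-- the last column of the differential -/
noncomputable def col {k n p : ℕ} (w : JetSpace k (n + 1) (p + 1)) : Fin (p + 1) → ℝ :=
  fun j => MvPolynomial.coeff (Finsupp.single (Fin.last n) 1) (w.1 j)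

/-- the last basis vector -/
def eVec (p : ℕ) : Fin (p + 1) → ℝ := Pi.single (Fin.last p) 1

@[simp] theorem eVec_last (p : ℕ) : eVec p (Fin.last p) = 1 := by simp [eVec]
@[simp] theorem eVec_castSucc {p : ℕ} (j : Fin p) : eVec p (Fin.castSucc j) = 0 := by
  simp [eVec]

theorem col_iPlusOne {k n p : ℕ} (hk : 1 ≤ k) (z : JetSpace k n p) :
    col (iPlusOne hk z) = eVec p := by
  funext j
  refine Fin.lastCases ?_ (fun j => ?_) j
  · simp [col, iPlusOne]
  · simp only [col, iPlusOne, Fin.snoc_castSucc, eVec_castSucc]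
    apply MvPolynomial.coeff_rename_eq_zero
    intro u hu
    exfalso
    have := DFunLike.congr_fun hu (Fin.last n)
    rw [Finsupp.mapDomain_notin_range] at this
    · simp at this
    · rintro ⟨i, hi⟩
      exact (Fin.castSucc_lt_last i).ne hi

theorem trunc_self {k n p : ℕ} (w : JetSpace k n p) : truncJet k n p w.1 = w := by
  apply Subtype.ext
  funext j
  exact truncPoly_jet w j

theorem continuous_col {k n p : ℕ} : Continuous (col : JetSpace k (n + 1) (p + 1) → _) :=
  continuous_pi fun j => (cont_iff_cc.1 continuous_id j) _

/-- substitution `y ↦ y + μ` -/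
noncomputable def subst {n : ℕ} (μ : MvPolynomial (Fin (n + 1)) ℝ) :
    Fin (n + 1) → MvPolynomial (Fin (n + 1)) ℝ :=
  fun i => MvPolynomial.X i + (if i = Fin.last n then μ else 0)

open MvPolynomial in
theorem subst_mem {n r : ℕ} {μ : MvPolynomial (Fin (n + 1)) ℝ}
    (hμ : μ ∈ idealOfVars (Fin (n + 1)) ℝ ^ (r + 1)) (f : MvPolynomial (Fin (n + 1)) ℝ) :
    aeval (subst μ) f - f - C (coeff (Finsupp.single (Fin.last n) 1) f) * μ ∈
      idealOfVars (Fin (n + 1)) ℝ ^ (r + 2) := by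
  have hX : ∀ i : Fin (n + 1), (X i : MvPolynomial (Fin (n + 1)) ℝ) ∈ idealOfVars (Fin (n + 1)) ℝ :=
    fun i => Ideal.subset_span ⟨i, rfl⟩
  have hweak : ∀ f : MvPolynomial (Fin (n + 1)) ℝ,
      aeval (subst μ) f - f ∈ idealOfVars (Fin (n + 1)) ℝ ^ (r + 1) := by
    intro f
    have := aeval_sub_mem (idealOfVars (Fin (n + 1)) ℝ ^ (r + 1)) (subst μ) X (fun i => by
      simp only [subst, add_sub_cancel_left]
      split_ifs
      · exact hμ
      · exact zero_mem _) f
    simpa [aeval_X_left] using this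
  induction f using MvPolynomial.induction_on with
  | C a =>
    have : coeff (Finsupp.single (Fin.last n) 1) (C a : MvPolynomial (Fin (n + 1)) ℝ) = 0 := by
      rw [coeff_C, if_neg]
      intro h
      exact one_ne_zero (Finsupp.single_eq_zero.1 h.symm)
    rw [this]
    simp
  | add f g hf hg =>
    have := add_mem hf hg
    convert this using 1
    simp only [map_add, coeff_add]
    ring
  | mul_X f i hf =>
    by_cases hi : i = Fin.last n
    · subst hi
      have hc : coeff (Finsupp.single (Fin.last n) 1) (f * X (Fin.last n)) = constantCoeff f := by
        have := coeff_mul_X 0 (Fin.last n) f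
        simpa [constantCoeff_eq] using this
      rw [hc]
      have hm : f - C (constantCoeff f) ∈ idealOfVars (Fin (n + 1)) ℝ := by
        have := (mem_pow_idealOfVars_iff' 1 (f - C (constantCoeff f))).2 (by
          intro d hd
          have : d = 0 := by rw [← Finsupp.degree_eq_zero_iff]; omega
          subst this
          simp [constantCoeff_eq])
        simpa using this
      have hy : X (Fin.last n) + μ ∈ idealOfVars (Fin (n + 1)) ℝ :=
        add_mem (hX _) (Ideal.pow_le_self (by omega) hμ)
      have h1 := Ideal.mul_mem_mul (hweak f) hy
      have h2 := Ideal.mul_mem_mul hμ hm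
      rw [← pow_succ] at h1 h2
      convert add_mem h1 h2 using 1
      rw [map_mul, aeval_X]
      simp only [subst, if_true]
      ring
    · have hc : coeff (Finsupp.single (Fin.last n) 1) (f * X i) = 0 := by
        classical
        rw [coeff_mul_X', if_neg]
        simp [Finsupp.mem_support_iff, Finsupp.single_apply]
        exact hi
      rw [hc]
      have h1 := Ideal.mul_mem_mul (hweak f) (hX i)
      rw [← pow_succ] at h1
      convert h1 using 1
      rw [map_mul, aeval_X]
      simp only [subst, if_neg hi]
      simp
      ring

/-- global deformations -/
def GDef {k n p : ℕ} (hk : 1 ≤ k) (S S' : Set (JetSpace k (n + 1) (p + 1))) : Prop :=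
  ∃ H : ℝ → JetSpace k (n + 1) (p + 1) → JetSpace k (n + 1) (p + 1),
    Continuous (fun q : ℝ × JetSpace k (n + 1) (p + 1) => H q.1 q.2) ∧ (∀ w, H 0 w = w) ∧
    (∀ t, ∀ w ∈ S, KE w (H t w)) ∧ (∀ w ∈ S, H 1 w ∈ S') ∧
    ∀ t (z : JetSpace k n p), H t (iPlusOne hk z) = iPlusOne hk z

theorem GDef.trans {k n p : ℕ} {hk : 1 ≤ k} {S S' S'' : Set (JetSpace k (n + 1) (p + 1))}
    (h1 : GDef hk S S') (h2 : GDef hk S' S'') : GDef hk S S'' := by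
  obtain ⟨H1, c1, z1, k1, o1, i1⟩ := h1
  obtain ⟨H2, c2, z2, k2, o2, i2⟩ := h2
  refine ⟨fun t w => H2 (max 0 (2 * t - 1)) (H1 (min 1 (2 * t)) w), ?_, ?_, ?_, ?_, ?_⟩
  · have a1 : Continuous (fun q : ℝ × JetSpace k (n + 1) (p + 1) => H1 (min 1 (2 * q.1)) q.2) :=
      c1.comp (f := fun q : ℝ × JetSpace k (n + 1) (p + 1) => (min 1 (2 * q.1), q.2)) (by fun_prop)
    exact c2.comp (f := fun q : ℝ × JetSpace k (n + 1) (p + 1) =>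
      (max 0 (2 * q.1 - 1), H1 (min 1 (2 * q.1)) q.2)) (Continuous.prodMk (by fun_prop) a1)
  · intro w
    simp [z1, z2]
  · intro t w hw
    by_cases ht : 2 * t ≤ 1
    · have : max 0 (2 * t - 1) = 0 := max_eq_left (by linarith)
      simp only [this, z2]
      exact k1 _ w hw
    · have : min 1 (2 * t) = 1 := min_eq_left (by linarith)
      simp only [this]
      exact (k1 1 w hw).trans (k2 _ _ (o1 w hw))
  · intro w hw
    have e1 : min 1 (2 * (1 : ℝ)) = 1 := by norm_num
    have e2 : max 0 (2 * (1 : ℝ) - 1) = 1 := by norm_num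
    simp only [e1, e2]
    exact o2 _ (o1 w hw)
  · intro t z
    simp [i1, i2]

theorem GDef.refl {k n p : ℕ} (hk : 1 ≤ k) (S : Set (JetSpace k (n + 1) (p + 1))) :
    GDef hk S S :=
  ⟨fun _ w => w, continuous_snd, fun _ => rfl, fun _ w _ => KE.refl w, fun _ h => h,
    fun _ _ => rfl⟩

/-- the filtration -/
def Sr {k n p : ℕ} (r : ℕ) : Set (JetSpace k (n + 1) (p + 1)) :=
  {w | col w = eVec p ∧ ∀ d : Fin (n + 1) →₀ ℕ, d.degree ≤ r →
    MvPolynomial.coeff d (w.1 (Fin.last p)) =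
      MvPolynomial.coeff d (MvPolynomial.X (Fin.last n) : MvPolynomial (Fin (n + 1)) ℝ)}

open MvPolynomial in
theorem coeff_X_of_ne {n : ℕ} {i : Fin n} {d : Fin n →₀ ℕ} (h : d.degree ≠ 1) :
    coeff d (X i : MvPolynomial (Fin n) ℝ) = 0 := by
  classical
  rw [coeff_X', if_neg]
  rintro rfl
  simp at h

open MvPolynomial in
theorem subst_inj {n : ℕ} {μ : MvPolynomial (Fin (n + 1)) ℝ} (h0 : constantCoeff μ = 0)
    (h1 : coeff (Finsupp.single (Fin.last n) 1) μ = 0) :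
    Function.Injective (fderiv ℝ (fun (x : Fin (n + 1) → ℝ) i => eval x (subst μ i)) 0) := by
  have hd := (sg_mvpoly μ).diff.hasFDerivAt
  have : HasFDerivAt (fun (x : Fin (n + 1) → ℝ) i => eval x (subst μ i))
    (ContinuousLinearMap.id ℝ _ + (fderiv ℝ (fun x : Fin (n + 1) → ℝ => eval x μ) 0).smulRight
      (Pi.single (Fin.last n) (1 : ℝ) : Fin (n + 1) → ℝ)) 0 := by
    have h2 := (hasFDerivAt_id (𝕜 := ℝ) (0 : Fin (n + 1) → ℝ)).add
      (hd.smul_const (Pi.single (Fin.last n) (1 : ℝ) : Fin (n + 1) → ℝ))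
    convert! h2 using 1
    funext x i
    by_cases hi : i = Fin.last n
    · subst hi; simp [subst]
    · simp [subst, hi]
  rw [this.fderiv, injective_iff_map_eq_zero]
  intro V hV
  have hc : ∀ i : Fin n, V (Fin.castSucc i) = 0 := by
    intro i
    have := congrFun hV (Fin.castSucc i)
    simpa using this
  have hz : fderiv ℝ (fun x : Fin (n + 1) → ℝ => eval x μ) 0 V = 0 := by
    rw [fderiv_poly h0, Fin.sum_univ_castSucc]
    simp [hc, h1]
  funext i
  have := congrFun hV i
  simpa [hz] using this

open MvPolynomial in
theorem gdef_step {k n p : ℕ} (hk : 1 ≤ k) (r : ℕ) :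
    GDef hk (Sr r : Set (JetSpace k (n + 1) (p + 1))) (Sr (r + 1)) := by
  let ν : JetSpace k (n + 1) (p + 1) → MvPolynomial (Fin (n + 1)) ℝ :=
    fun w => w.1 (Fin.last p) - X (Fin.last n)
  have hν0 : ∀ w, constantCoeff (ν w) = 0 := by
    intro w; simp [ν, (w.2 (Fin.last p)).2]
  have hνm : ∀ w ∈ (Sr r : Set (JetSpace k (n + 1) (p + 1))),
      ν w ∈ idealOfVars (Fin (n + 1)) ℝ ^ (r + 1) := by
    intro w hw
    rw [mem_pow_idealOfVars_iff']
    intro d hd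
    rw [coeff_sub, hw.2 d (by omega), sub_self]
  have hν1 : ∀ w ∈ (Sr r : Set (JetSpace k (n + 1) (p + 1))),
      coeff (Finsupp.single (Fin.last n) 1) (ν w) = 0 := by
    intro w hw
    have := congrFun hw.1 (Fin.last p)
    simp only [col, eVec_last] at this
    simp [ν, this]
  have hself : ∀ w : JetSpace k (n + 1) (p + 1), 
      (truncJet k (n + 1) (p + 1) fun j => aeval (subst 0) (w.1 j)) = w := by
    intro w
    have e : (subst 0 : Fin (n + 1) → _) = X := by
      funext i; simp [subst]
    rw [e]
    simpa [aeval_X_left] using! trunc_self w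
  refine ⟨fun t w => truncJet k (n + 1) (p + 1) fun j => aeval (subst (C (-t) * ν w)) (w.1 j),
    ?_, ?_, ?_, ?_, ?_⟩
  · refine cont_truncJet fun j => cc_aeval continuous_snd j fun i => ?_
    simp only [subst]
    refine (cc_const _).add ?_
    split_ifs
    · exact (cc_C (by fun_prop)).mul ((cont_iff_cc.1 continuous_snd _).sub (cc_const _))
    · exact cc_const _
  · intro w
    simpa using hself w
  · intro t w hw
    have h0 : constantCoeff (C (-t) * ν w) = 0 := by rw [map_mul, hν0, mul_zero]
    refine move_sub w _ ?_ (subst_inj h0 ?_)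
    · intro i
      simp only [subst, map_add, constantCoeff_X, zero_add]
      split_ifs
      · exact h0
      · simp
    · rw [coeff_C_mul, hν1 w hw, mul_zero]
  · intro w hw
    have hμ : C (-1 : ℝ) * ν w ∈ idealOfVars (Fin (n + 1)) ℝ ^ (r + 1) :=
      Ideal.mul_mem_left _ _ (hνm w hw)
    have hs := fun j => (mem_pow_idealOfVars_iff' _ _).1 (subst_mem hμ (w.1 j))
    constructor
    · funext j
      have h1 := hs j (Finsupp.single (Fin.last n) 1) (by simp)
      simp only [coeff_sub, coeff_C_mul, hν1 w hw, mul_zero, sub_zero] at h1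
      have h2 := congrFun hw.1 j
      simp only [col] at h2 ⊢
      simp only [truncJet]
      rw [coeff_truncPoly, if_pos (by simpa using hk), ← h2]
      linarith
    · intro d hd
      simp only [truncJet]
      rw [coeff_truncPoly]
      split_ifs with hdk
      · have h1 := hs (Fin.last p) d (by omega)
        have h2 := congrFun hw.1 (Fin.last p)
        simp only [col, eVec_last] at h2
        rw [h2] at h1
        simp only [coeff_sub, coeff_C_mul, ν] at h1
        linarith
      · exact (coeff_X_of_ne (by omega)).symm
  · intro t z
    have : ν (iPlusOne hk z) = 0 := by simp [ν, iPlusOne]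
    simp only [this, mul_zero]
    exact hself _

open MvPolynomial in
theorem rename_truncPoly {k n : ℕ} (f : MvPolynomial (Fin n) ℝ) :
    rename Fin.castSucc (truncPoly k f) = truncPoly k (rename Fin.castSucc f) := by
  have hinj : Function.Injective (Fin.castSucc : Fin n → Fin (n + 1)) := Fin.castSucc_injective n
  ext d
  rw [coeff_truncPoly]
  by_cases hd : ∃ u : Fin n →₀ ℕ, u.mapDomain Fin.castSucc = d
  · obtain ⟨u, rfl⟩ := hd
    rw [coeff_rename_mapDomain _ hinj, coeff_rename_mapDomain _ hinj, coeff_truncPoly]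
    have : (u.mapDomain (Fin.castSucc : Fin n → Fin (n + 1))).degree = u.degree := by
      exact Finsupp.degree_mapDomain _ _
    rw [this]
  · have h : ∀ g : MvPolynomial (Fin n) ℝ, coeff d (rename Fin.castSucc g) = 0 := fun g =>
      coeff_rename_eq_zero _ _ _ fun u hu => absurd ⟨u, hu⟩ hd
    rw [h, h]; simp

/-- restriction of a jet to the hyperplane, forgetting the last component -/
noncomputable def rho {k n p : ℕ} (w : JetSpace k (n + 1) (p + 1)) : JetSpace k n p :=
  truncJet k n p fun j => MvPolynomial.aeval
    (fun i => Fin.lastCases (motive := fun _ => MvPolynomial (Fin n) ℝ) 0 MvPolynomial.X i)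
    (w.1 (Fin.castSucc j))

theorem continuous_rho {k n p : ℕ} :
    Continuous (rho : JetSpace k (n + 1) (p + 1) → JetSpace k n p) :=
  cont_truncJet fun j => cc_aeval continuous_id _ fun i => cc_const _

open MvPolynomial in
theorem rho_iPlusOne {k n p : ℕ} (hk : 1 ≤ k) (z : JetSpace k n p) : rho (iPlusOne hk z) = z := by
  have : rho (iPlusOne hk z) = truncJet k n p z.1 := by
    unfold rho
    congr 1
    funext j
    simp only [iPlusOne, Fin.snoc_castSucc]
    rw [aeval_rename]
    have : (fun i => Fin.lastCases (motive := fun _ => MvPolynomial (Fin n) ℝ) 0 X i) ∘ Fin.castSucc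
       = (X : Fin n → MvPolynomial (Fin n) ℝ) := by
      funext i; simp
    rw [this, aeval_X_left]; rfl
  rw [this, trunc_self]

open MvPolynomial in
theorem gdef_last {k n p : ℕ} (hk : 1 ≤ k) :
    GDef hk (Sr k : Set (JetSpace k (n + 1) (p + 1))) (Set.range (iPlusOne hk)) := by
  let q0 : JetSpace k (n + 1) (p + 1) → Fin p → MvPolynomial (Fin (n + 1)) ℝ := fun w j =>
    rename Fin.castSucc (aeval
      (fun i => Fin.lastCases (motive := fun _ => MvPolynomial (Fin n) ℝ) 0 X i) 
        (w.1 (Fin.castSucc j)))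
  have hq : ∀ w j, ∃ q, w.1 (Fin.castSucc j) - q0 w j = X (Fin.last n) * q := by
    intro w j
    have e : q0 w j = aeval (fun i => if i = Fin.last n then 0 else X i) (w.1 (Fin.castSucc j)) := by
      have : (rename (R := ℝ) (Fin.castSucc : Fin n → Fin (n + 1))).comp (aeval
          (fun i => Fin.lastCases (motive := fun _ => MvPolynomial (Fin n) ℝ) 0 X i)) = 
          aeval (fun i => if i = Fin.last n then 0 else X i) := by
        ext1 i
        refine Fin.lastCases ?_ (fun i => ?_) i <;> simp [(Fin.castSucc_lt_last _).ne]
      exact congrArg (fun f => f (w.1 (Fin.castSucc j))) this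
    have := aeval_sub_mem (Ideal.span {(X (Fin.last n) : MvPolynomial (Fin (n + 1)) ℝ)}) X
      (fun i => if i = Fin.last n then 0 else X i) (fun i => by
        split_ifs with h
        · subst h; rw [sub_zero]; exact Ideal.subset_span rfl
        · rw [sub_self]; exact zero_mem _) (w.1 (Fin.castSucc j))
    rw [← e, Ideal.mem_span_singleton] at this
    obtain ⟨q, hq⟩ := this
    refine ⟨q, ?_⟩
    rw [← hq, aeval_X_left]; rfl
  choose Q hQ using hq
  have hX : ∀ w ∈ (Sr k : Set (JetSpace k (n + 1) (p + 1))), w.1 (Fin.last p) = X (Fin.last n) := by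
    intro w hw
    ext d
    by_cases hd : d.degree ≤ k
    · exact hw.2 d hd
    · rw [coeff_X_of_ne (by omega)]
      by_contra h
      exact hd (degree_le_of_coeff_ne w _ h).2
  refine ⟨fun t w => truncJet k (n + 1) (p + 1) (Fin.snoc (α := fun _ => MvPolynomial (Fin (n + 1)) ℝ)
      (fun j => C (1 - t) * w.1 (Fin.castSucc j) + C t * rename Fin.castSucc ((rho w).1 j))
      (w.1 (Fin.last p))), ?_, ?_, ?_, ?_, ?_⟩
  · refine cont_truncJet fun j => ?_
    refine Fin.lastCases ?_ (fun j => ?_) j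
    · simp only [Fin.snoc_last]
      exact cont_iff_cc.1 continuous_snd _
    · simp only [Fin.snoc_castSucc]
      refine CC.add ((cc_C (by fun_prop)).mul (cont_iff_cc.1 continuous_snd _))
        ((cc_C (by fun_prop)).mul ?_)
      have := cc_aeval (continuous_rho.comp (continuous_snd (X := ℝ)
        (Y := JetSpace k (n + 1) (p + 1)))) j (h := fun _ i => X (Fin.castSucc i))
        (fun i => cc_const _)
      have e : rename (R := ℝ) (Fin.castSucc : Fin n → Fin (n + 1)) =
          aeval (fun i => X (Fin.castSucc i)) := by
        ext1 i; simp
      rw [e]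
      exact this
  · intro w
    conv_rhs => rw [← trunc_self w]
    beta_reduce
    congr 1
    funext j
    refine Fin.lastCases ?_ (fun j => ?_) j <;> simp
  · intro t w hw
    have h := move_mat w (shear fun j => C t * Q w j) (by
      convert! shear_isUnit (fun j => eval 0 (C t * Q w j)) using 1
      ext i j
      simp only [shear, Matrix.of_apply, map_sub]
      congr 1
      · split_ifs <;> simp
      · split_ifs
        · refine Fin.lastCases ?_ (fun i => ?_) i <;> simp
        · simp)
    rw [shear_mulVec] at h
    convert! h using 1
    apply Subtype.ext
    funext j
    refine Fin.lastCases ?_ (fun j => ?_) j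
    · simp [truncJet]
    · simp only [truncJet, Fin.snoc_castSucc, rho, rename_truncPoly]
      have := hQ w j
      rw [hX w hw]
      have e1 : C t * Q w j * X (Fin.last n) = C t * (w.1 (Fin.castSucc j) - q0 w j) := by
        rw [this]; ring
      rw [e1]
      ext d
      simp only [coeff_truncPoly]
      split_ifs with hd
      · simp only [coeff_add, coeff_sub, coeff_C_mul, coeff_truncPoly, if_pos hd, q0]
        ring
      · rfl
  · intro w hw
    refine ⟨rho w, ?_⟩
    rw [← trunc_self (iPlusOne hk (rho w))]
    congr 1
    funext j
    refine Fin.lastCases ?_ (fun j => ?_) j 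
    · simp [iPlusOne, hX w hw]
    · simp [iPlusOne]
  · intro t z
    conv_rhs => rw [← trunc_self (iPlusOne hk z)]
    beta_reduce
    rw [rho_iPlusOne]
    congr 1
    funext j
    refine Fin.lastCases ?_ (fun j => ?_) j 
    · simp [iPlusOne]
    · simp only [iPlusOne, Fin.snoc_castSucc]
      rw [← add_mul, ← map_add]; simp

theorem gdef_e {k n p : ℕ} (hk : 1 ≤ k) :
    GDef hk {w : JetSpace k (n + 1) (p + 1) | col w = eVec p} (Set.range (iPlusOne hk)) := by
  have h0 : {w : JetSpace k (n + 1) (p + 1) | col w = eVec p} = Sr 0 := by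
    ext w
    refine ⟨fun h => ⟨h, fun d hd => ?_⟩, fun h => h.1⟩
    rw [coeff_X_of_ne (by omega)]
    by_contra h
    have := (degree_le_of_coeff_ne w _ h).1
    omega
  have h1 : ∀ r, GDef hk (Sr 0 : Set (JetSpace k (n + 1) (p + 1))) (Sr r) := by
    intro r
    induction r with
    | zero => exact GDef.refl hk _
    | succ r ih => exact ih.trans (gdef_step hk r)
  rw [h0]
  exact (h1 k).trans (gdef_last hk)

/-- complement of the closed negative ray spanned by the last basis vector -/
def NR (p : ℕ) : Set (Fin (p + 1) → ℝ) :=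
  {v | ¬ ((∀ j : Fin p, v (Fin.castSucc j) = 0) ∧ v (Fin.last p) ≤ 0)}

theorem isOpen_NR (p : ℕ) : IsOpen (NR p) := by
  have : IsClosed {v : Fin (p + 1) → ℝ |
      (∀ j : Fin p, v (Fin.castSucc j) = 0) ∧ v (Fin.last p) ≤ 0} := by
    refine IsClosed.inter (s₁ := {v : Fin (p + 1) → ℝ | ∀ j : Fin p, v (Fin.castSucc j) = 0})
      (s₂ := {v : Fin (p + 1) → ℝ | v (Fin.last p) ≤ 0}) ?_ ?_
    · simp only [Set.setOf_forall]
      exact isClosed_iInter fun j => isClosed_eq (by fun_prop) (by fun_prop)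
    · exact isClosed_le (by fun_prop) (by fun_prop)
  exact this.isOpen_compl

theorem NR_star {p : ℕ} {v : Fin (p + 1) → ℝ} (hv : v ∈ NR p) {t : ℝ} (h0 : 0 ≤ t) (h1 : t ≤ 1) :
    (1 - t) • eVec p + t • v ∈ NR p := by
  rintro ⟨ha, hb⟩
  simp at ha hb
  rcases h0.eq_or_lt with rfl | ht
  · simp at hb; linarith
  · have hz : ∀ j : Fin p, v (Fin.castSucc j) = 0 := fun j => (ha j).resolve_left ht.ne'
    have hl : 0 < v (Fin.last p) := by
      by_contra h
      exact hv ⟨hz, not_lt.1 h⟩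
    nlinarith [mul_pos ht hl]

/-- diagonal entry -/
noncomputable def alph {p : ℕ} (v : Fin (p + 1) → ℝ) : ℝ :=
  (∑ j : Fin p, v (Fin.castSucc j) ^ 2 + max (v (Fin.last p)) 0) / (1 + max (- v (Fin.last p)) 0)

/-- a matrix sending the last basis vector to `v` -/
noncomputable def Rm {p : ℕ} (v : Fin (p + 1) → ℝ) : Matrix (Fin (p + 1)) (Fin (p + 1)) ℝ :=
  Matrix.of fun i j => if j = Fin.last p then v i else if i = Fin.last p then - v j else
    if i = j then alph v else 0

theorem Rm_e {p : ℕ} : Rm (eVec p) = 1 := by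
  have ha : alph (eVec p) = 1 := by simp [alph]
  ext i j
  simp only [Rm, Matrix.of_apply, ha, Matrix.one_apply]
  refine Fin.lastCases ?_ (fun j => ?_) j
  · refine Fin.lastCases ?_ (fun i => ?_) i <;> simp [(Fin.castSucc_lt_last _).ne]
  · refine Fin.lastCases ?_ (fun i => ?_) i <;> simp [(Fin.castSucc_lt_last _).ne,
      (Fin.castSucc_lt_last _).ne']

theorem Rm_mulVec {p : ℕ} (v : Fin (p + 1) → ℝ) : (Rm v).mulVec (eVec p) = v := by
  funext i
  simp [Rm, Matrix.mulVec, dotProduct, Fin.sum_univ_castSucc]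

theorem Rm_isUnit {p : ℕ} {v : Fin (p + 1) → ℝ} (hv : v ∈ NR p) : IsUnit (Rm v) := by
  apply isUnit_of_inj
  intro x hx
  have hc : ∀ i : Fin p, alph v * x (Fin.castSucc i) + v (Fin.castSucc i) * x (Fin.last p) = 0 := by
    intro i
    have := congrFun hx (Fin.castSucc i)
    simpa [Rm, Matrix.mulVec, dotProduct, Fin.sum_univ_castSucc, (Fin.castSucc_lt_last _).ne]
      using this
  have hl : -(∑ j : Fin p, v (Fin.castSucc j) * x (Fin.castSucc j)) +
      v (Fin.last p) * x (Fin.last p) = 0 := by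
    have := congrFun hx (Fin.last p)
    simpa [Rm, Matrix.mulVec, dotProduct, Fin.sum_univ_castSucc, (Fin.castSucc_lt_last _).ne]
      using this
  set S := ∑ j : Fin p, v (Fin.castSucc j) ^ 2 with hS
  have hS0 : 0 ≤ S := Finset.sum_nonneg fun j _ => sq_nonneg _
  have hpos : 0 < S ∨ 0 < v (Fin.last p) := by
    by_contra h
    push Not at h
    have hz : S = 0 := le_antisymm h.1 hS0
    rw [hS, Finset.sum_eq_zero_iff_of_nonneg fun j _ => sq_nonneg _] at hz
    exact hv ⟨fun j => by simpa using hz j (Finset.mem_univ j), h.2⟩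
  have hx2 : (S + alph v * v (Fin.last p)) * x (Fin.last p) = 0 := by
    have : ∑ j : Fin p, v (Fin.castSucc j) * (alph v * x (Fin.castSucc j)) = - S * x (Fin.last p) := by
      rw [hS, ← Finset.sum_neg_distrib, Finset.sum_mul]
      refine Finset.sum_congr rfl fun j _ => ?_
      have := hc j
      have e : alph v * x (Fin.castSucc j) = - (v (Fin.castSucc j) * x (Fin.last p)) := by linarith
      rw [e]; ring
    have h3 : ∑ j : Fin p, v (Fin.castSucc j) * (alph v * x (Fin.castSucc j)) =
        alph v * ∑ j : Fin p, v (Fin.castSucc j) * x (Fin.castSucc j) := by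
      rw [Finset.mul_sum]
      exact Finset.sum_congr rfl fun j _ => by ring
    have h4 := congrArg (fun y => alph v * y) hl
    simp only [mul_add, mul_zero, mul_neg, ← h3, this] at h4
    linarith
  have ha : 0 < alph v ∧ 0 < S + alph v * v (Fin.last p) := by
    rcases le_or_gt 0 (v (Fin.last p)) with h | h
    · have e : alph v = S + v (Fin.last p) := by
        simp [alph, max_eq_left h, max_eq_right (neg_nonpos.2 h), hS]
      rw [e]
      refine ⟨by rcases hpos with h' | h' <;> linarith, ?_⟩
      rcases hpos with h' | h'
      · nlinarith [mul_nonneg hS0 h]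
      · nlinarith [mul_nonneg hS0 h]
    · have hS' : 0 < S := hpos.resolve_right (by linarith)
      have e : alph v = S / (1 - v (Fin.last p)) := by
        simp [alph, max_eq_right h.le, max_eq_left (neg_nonneg.2 h.le), hS, sub_eq_add_neg]
      have hd : 0 < 1 - v (Fin.last p) := by linarith
      have e2 : S + S / (1 - v (Fin.last p)) * v (Fin.last p) = S / (1 - v (Fin.last p)) := by
        field_simp; ring
      rw [e, e2]
      exact ⟨by positivity, by positivity⟩
  have hxl : x (Fin.last p) = 0 := (mul_eq_zero.1 hx2).resolve_left ha.2.ne'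
  funext i
  refine Fin.lastCases hxl (fun i => ?_) i
  have := hc i
  rw [hxl, mul_zero, add_zero] at this
  exact (mul_eq_zero.1 this).resolve_left ha.1.ne'

theorem continuous_Rm {p : ℕ} : Continuous (Rm : (Fin (p + 1) → ℝ) → _) := by
  have ha : Continuous (alph : (Fin (p + 1) → ℝ) → ℝ) := by
    unfold alph
    refine Continuous.div (by fun_prop) (by fun_prop) fun v => ?_
    have := le_max_right (-v (Fin.last p)) 0
    linarith
  refine continuous_matrix fun i j => ?_
  simp only [Rm, Matrix.of_apply]
  split_ifs <;> fun_prop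

theorem col_mulVec {k n p : ℕ} (hk : 1 ≤ k) (M : Matrix (Fin (p + 1)) (Fin (p + 1)) ℝ)
    (w : JetSpace k (n + 1) (p + 1)) :
    col (truncJet k (n + 1) (p + 1) ((M.map MvPolynomial.C).mulVec w.1)) = M.mulVec (col w) := by
  funext j
  simp only [col, truncJet]
  rw [coeff_truncPoly, if_pos (by simpa using hk)]
  simp [Matrix.mulVec, dotProduct, MvPolynomial.coeff_sum, MvPolynomial.coeff_C_mul, col]

theorem red {k n p : ℕ} (hk : 1 ≤ k) :
    ∃ H : ℝ → JetSpace k (n + 1) (p + 1) → JetSpace k (n + 1) (p + 1),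
      ContinuousOn (fun q : ℝ × JetSpace k (n + 1) (p + 1) => H q.1 q.2)
        (Set.Icc 0 1 ×ˢ {w | col w ∈ NR p}) ∧
      (∀ w, col w ∈ NR p → H 0 w = w) ∧
      (∀ t ∈ Set.Icc (0 : ℝ) 1, ∀ w, col w ∈ NR p → KE w (H t w)) ∧
      (∀ w, col w ∈ NR p → ∃ z, H 1 w = iPlusOne hk z) ∧
      ∀ t ∈ Set.Icc (0 : ℝ) 1, ∀ z : JetSpace k n p, H t (iPlusOne hk z) = iPlusOne hk z := by
  obtain ⟨H2, c2, z2, k2, o2, i2⟩ := gdef_e (n := n) (p := p) hk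
  let H1 : ℝ → JetSpace k (n + 1) (p + 1) → JetSpace k (n + 1) (p + 1) := fun t w =>
    truncJet k (n + 1) (p + 1)
      ((((Rm ((1 - t) • eVec p + t • col w))⁻¹).map MvPolynomial.C).mulVec w.1)
  have c1 : ContinuousOn (fun q : ℝ × JetSpace k (n + 1) (p + 1) => H1 q.1 q.2)
        (Set.Icc 0 1 ×ˢ {w | col w ∈ NR p}) := by
    rw [continuousOn_iff_continuous_domRestrict]
    refine cont_truncJet fun j => ?_
    simp only [Matrix.mulVec, dotProduct, Matrix.map_apply]
    refine CC.sum _ fun i => (cc_C ?_).mul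
      (cont_iff_cc.1 (continuous_snd.comp continuous_subtype_val) i)
    have hR : Continuous fun q : (Set.Icc (0 : ℝ) 1 ×ˢ
        {w : JetSpace k (n + 1) (p + 1) | col w ∈ NR p} : Set _) =>
        Rm ((1 - q.1.1) • eVec p + q.1.1 • col q.1.2) := by
      refine continuous_Rm.comp ?_
      have := continuous_col (k := k) (n := n) (p := p)
      fun_prop
    simp only [Matrix.inv_def, Ring.inverse_eq_inv', Matrix.smul_apply, smul_eq_mul]
    refine Continuous.mul (Continuous.inv₀ hR.matrix_det fun q => ?_) 
      (hR.matrix_adjugate.matrix_elem j i)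
    have := Rm_isUnit (NR_star q.2.2 q.2.1.1 q.2.1.2)
    exact ((Matrix.isUnit_iff_isUnit_det _).1 this).ne_zero
  have z1 : ∀ w, H1 0 w = w := by
    intro w
    simp only [H1, sub_zero, one_smul, zero_smul, add_zero, Rm_e, inv_one]
    rw [Matrix.map_one _ (map_zero _) (map_one _), Matrix.one_mulVec, trunc_self]
  have k1 : ∀ t ∈ Set.Icc (0 : ℝ) 1, ∀ w, col w ∈ NR p → KE w (H1 t w) := by
    intro t ht w hw
    refine move_mat w _ ?_
    have := Rm_isUnit (NR_star hw ht.1 ht.2)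
    simp only [Matrix.map_apply, MvPolynomial.eval_C]
    exact (Matrix.isUnit_nonsing_inv_iff).2 this
  have o1 : ∀ w, col w ∈ NR p → col (H1 1 w) = eVec p := by
    intro w hw
    simp only [H1, sub_self, zero_smul, zero_add, one_smul, col_mulVec hk]
    have h := congrArg ((Rm (col w))⁻¹.mulVec) (Rm_mulVec (col w))
    rw [← h, Matrix.mulVec_mulVec, Matrix.nonsing_inv_mul, Matrix.one_mulVec]
    exact (Matrix.isUnit_iff_isUnit_det _).1 (Rm_isUnit hw)
  have i1 : ∀ t (z : JetSpace k n p), H1 t (iPlusOne hk z) = iPlusOne hk z := by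
    intro t z
    simp only [H1, col_iPlusOne]
    rw [← add_smul, sub_add_cancel, one_smul, Rm_e, inv_one,
      Matrix.map_one _ (map_zero _) (map_one _), Matrix.one_mulVec, trunc_self]
  refine ⟨fun t w => H2 (max 0 (2 * t - 1)) (H1 (min 1 (2 * t)) w), ?_, ?_, ?_, ?_, ?_⟩
  · have a1 : ContinuousOn (fun q : ℝ × JetSpace k (n + 1) (p + 1) => H1 (min 1 (2 * q.1)) q.2)
        (Set.Icc 0 1 ×ˢ {w | col w ∈ NR p}) :=
      c1.comp (f := fun q : ℝ × JetSpace k (n + 1) (p + 1) => (min 1 (2 * q.1), q.2))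
        (by fun_prop) (by
          rintro ⟨t, w⟩ ⟨ht, hw⟩
          refine ⟨⟨le_min zero_le_one (by linarith [ht.1]), min_le_left _ _⟩, hw⟩)
    exact c2.comp_continuousOn (f := fun q : ℝ × JetSpace k (n + 1) (p + 1) =>
      (max 0 (2 * q.1 - 1), H1 (min 1 (2 * q.1)) q.2)) (ContinuousOn.prodMk (by fun_prop) a1)
  · intro w hw
    simp [z1, z2]
  · intro t ht w hw
    by_cases ht' : 2 * t ≤ 1
    · have : max 0 (2 * t - 1) = 0 := max_eq_left (by linarith)
      simp only [this, z2]
      exact k1 _ ⟨le_min zero_le_one (by linarith [ht.1]), min_le_left _ _⟩ w hw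
    · have : min 1 (2 * t) = 1 := min_eq_left (by linarith)
      simp only [this]
      exact (k1 1 ⟨zero_le_one, le_rfl⟩ w hw).trans (k2 _ _ (o1 w hw))
  · intro w hw
    have e1 : min 1 (2 * (1 : ℝ)) = 1 := by norm_num
    have e2 : max 0 (2 * (1 : ℝ) - 1) = 1 := by norm_num
    simp only [e1, e2]
    obtain ⟨z, hz⟩ := o2 _ (o1 w hw)
    exact ⟨z, hz.symm⟩
  · intro t ht z
    simp [i1, i2]

theorem omega_ke {k n p : ℕ} {hk : 1 ≤ k} {Ω : Set (JetSpace k n p)}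
    {w w' : JetSpace k (n + 1) (p + 1)} (hw : w ∈ OmegaK hk Ω 1) (h : KE w w') :
    w' ∈ OmegaK hk Ω 1 := by
  obtain ⟨z, hz, h1⟩ := hw
  exact ⟨z, hz, (kequiv_iff _ _).2 (((kequiv_iff _ _).1 h1).trans h)⟩

theorem omega_iPlus {k n p : ℕ} {hk : 1 ≤ k} {Ω : Set (JetSpace k n p)} (hΩ : KInvariant Ω)
    {z : JetSpace k n p} (hw : iPlusOne hk z ∈ OmegaK hk Ω 1) : z ∈ Ω := by
  obtain ⟨z', hz, h1⟩ := hw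
  have h2 : KE (iPlusOne hk z') (iPlusOne hk z) := (kequiv_iff _ _).1 h1
  exact hΩ z' hz z ((kequiv_iff _ _).2 (cancel hk h2))

theorem iPlus_omega {k n p : ℕ} {hk : 1 ≤ k} {Ω : Set (JetSpace k n p)}
    {z : JetSpace k n p} (hz : z ∈ Ω) : iPlusOne hk z ∈ OmegaK hk Ω 1 :=
  ⟨z, hz, (kequiv_iff _ _).2 (KE.refl _)⟩

/-- linear forms of a linear map -/
noncomputable def linForms {n : ℕ} (A : (Fin n → ℝ) ≃L[ℝ] (Fin n → ℝ)) :
    Fin n → MvPolynomial (Fin n) ℝ :=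
  fun i => ∑ i', MvPolynomial.C (A (Pi.single i' 1) i) * MvPolynomial.X i'

theorem eval_linForms {n : ℕ} (A : (Fin n → ℝ) ≃L[ℝ] (Fin n → ℝ)) (x : Fin n → ℝ) :
    (fun i => MvPolynomial.eval x (linForms A i)) = A x := by
  funext i
  have : x = ∑ i', x i' • (Pi.single i' (1 : ℝ) : Fin n → ℝ) := by
    funext j; simp [Finset.sum_apply, Pi.single_apply]
  conv_rhs => rw [this]
  simp [linForms, map_sum, mul_comm]

/-- precomposition with a linear isomorphism -/
noncomputable def prec {k n p : ℕ} (A : (Fin n → ℝ) ≃L[ℝ] (Fin n → ℝ)) (w : JetSpace k n p) :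
    JetSpace k n p := truncJet k n p fun j => MvPolynomial.aeval (linForms A) (w.1 j)

theorem linForms_const {n : ℕ} (A : (Fin n → ℝ) ≃L[ℝ] (Fin n → ℝ)) (i : Fin n) :
    MvPolynomial.constantCoeff (linForms A i) = 0 := by
  simp [linForms]

theorem ke_prec {k n p : ℕ} (A : (Fin n → ℝ) ≃L[ℝ] (Fin n → ℝ)) (w : JetSpace k n p) :
    KE w (prec A w) := by
  refine move_sub w _ (linForms_const A) ?_
  have : (fun (x : Fin n → ℝ) i => MvPolynomial.eval x (linForms A i)) = A := by
    funext x; exact eval_linForms A x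
  rw [this, ContinuousLinearEquiv.fderiv]
  exact A.injective

theorem continuous_prec {k n p : ℕ} (A : (Fin n → ℝ) ≃L[ℝ] (Fin n → ℝ)) :
    Continuous (prec A : JetSpace k n p → JetSpace k n p) :=
  cont_truncJet fun j => cc_aeval continuous_id j fun _ => cc_const _

theorem fderiv_eval_apply {k n p : ℕ} (w : JetSpace k n p) (V : Fin n → ℝ) (j : Fin p) :
    fderiv ℝ w.eval 0 V j = fderiv ℝ (fun x => MvPolynomial.eval x (w.1 j)) 0 V := by
  have h := (sg_eval w).diff.hasFDerivAt
  rw [hasFDerivAt_pi'] at h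
  exact (congrArg (fun T => T V) (h j).fderiv).symm

theorem col_prec {k n p : ℕ} (hk : 1 ≤ k) (A : (Fin (n + 1) → ℝ) ≃L[ℝ] (Fin (n + 1) → ℝ))
    (w : JetSpace k (n + 1) (p + 1)) :
    col (prec A w) = fderiv ℝ w.eval 0 (A (Pi.single (Fin.last n) 1)) := by
  funext j
  rw [fderiv_eval_apply]
  simp only [col, prec, truncJet]
  rw [coeff_truncPoly, if_pos (by simpa using hk)]
  have h0 : MvPolynomial.constantCoeff (MvPolynomial.aeval (linForms A) (w.1 j)) = 0 := by
    rw [constantCoeff_aeval' _ (linForms_const A)]; exact (w.2 j).2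
  have h1 := fderiv_poly h0 (Pi.single (Fin.last n) 1)
  have h2 : (fun x => MvPolynomial.eval x (MvPolynomial.aeval (linForms A) (w.1 j))) =
      (fun x => MvPolynomial.eval x (w.1 j)) ∘ A := by
    funext x
    rw [eval_aeval', eval_linForms]; rfl
  have h3 : HasFDerivAt (fun x => MvPolynomial.eval x (w.1 j))
      (fderiv ℝ (fun x => MvPolynomial.eval x (w.1 j)) 0) (A 0) := by
    rw [map_zero]
    exact (sg_mvpoly (w.1 j)).diff.hasFDerivAt
  rw [h2, (h3.comp (0 : Fin (n + 1) → ℝ) A.hasFDerivAt).fderiv] at h1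
  simpa [Pi.single_apply] using h1.symm

theorem isOpen_omega {k n p : ℕ} (hk : 1 ≤ k) {Ω : Set (JetSpace k n p)} (hΩ : KInvariant Ω)
    (hO : IsOpen Ω) : IsOpen (OmegaK hk Ω 1 : Set (JetSpace k (n + 1) (p + 1))) := by
  obtain ⟨H, hc, -, hke, h1, -⟩ := red (n := n) (p := p) hk
  rw [isOpen_iff_mem_nhds]
  intro w0 hw0
  have hξ : ∃ ξ : Fin (n + 1) → ℝ, fderiv ℝ w0.eval 0 ξ ∈ NR p := by
    obtain ⟨z0, hz0, hkz⟩ := hw0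
    obtain ⟨h, M, h0, hh, hb, hM, hM0, he⟩ := (kequiv_iff _ _).1 hkz
    have hd := ke_deriv hk h0 hh hM he
    have hs : Function.Surjective (fderiv ℝ h 0) :=
      LinearMap.injective_iff_surjective.1 hb
    obtain ⟨v, hv⟩ := hs (Pi.single (Fin.last n) 1)
    have hne : fderiv ℝ w0.eval 0 v ≠ 0 := by
      intro h00
      rw [hd v, hv] at h00
      have h5 := inj_of_isUnit hM0 h00
      have h6 := fderiv_iPlusOne hk z0 (Pi.single (Fin.last n) 1)
      have h7 := congrFun (h6.symm.trans h5) (Fin.last p)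
      simp at h7
    by_contra hcon
    push Not at hcon
    have a1 := hcon v
    have a2 := hcon (-v)
    simp only [NR, Set.mem_ofPred_eq, not_not, map_neg, Pi.neg_apply] at a1 a2
    apply hne
    funext i
    refine Fin.lastCases ?_ (fun i => a1.1 i) i
    have := a1.2
    have := a2.2
    show fderiv ℝ w0.eval 0 v (Fin.last p) = 0
    linarith
  obtain ⟨ξ, hξ⟩ := hξ
  have hξ0 : ξ ≠ 0 := by
    rintro rfl
    rw [map_zero] at hξ
    exact hξ ⟨fun _ => rfl, le_rfl⟩
  obtain ⟨A, hA⟩ := SeparatingDual.exists_continuousLinearEquiv_apply_eq (R := ℝ)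
    (x := (Pi.single (Fin.last n) 1 : Fin (n + 1) → ℝ)) (y := ξ) (by
      intro h
      have := congrFun h (Fin.last n)
      simp at this) hξ0
  have hNo : IsOpen {w : JetSpace k (n + 1) (p + 1) | col (prec A w) ∈ NR p} :=
    (isOpen_NR p).preimage (continuous_col.comp (continuous_prec A))
  have hGc : ContinuousOn (fun w => rho (H 1 (prec A w)))
      {w : JetSpace k (n + 1) (p + 1) | col (prec A w) ∈ NR p} := by
    refine continuous_rho.comp_continuousOn ?_
    exact hc.comp (f := fun w => ((1 : ℝ), prec A w))
      (Continuous.continuousOn (continuous_const.prodMk (continuous_prec A)))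
      (fun w hw => ⟨⟨zero_le_one, le_rfl⟩, hw⟩)
  have hGo := hGc.isOpen_inter_preimage hNo hO
  have hKE : ∀ w : JetSpace k (n + 1) (p + 1), col (prec A w) ∈ NR p →
      KE w (iPlusOne hk (rho (H 1 (prec A w)))) := by
    intro w hw
    obtain ⟨z, hz⟩ := h1 _ hw
    have := (ke_prec A w).trans (hke 1 ⟨zero_le_one, le_rfl⟩ _ hw)
    rw [hz] at this ⊢
    rwa [rho_iPlusOne]
  refine mem_of_superset (hGo.mem_nhds ⟨?_, ?_⟩) ?_
  · show col (prec A w0) ∈ NR p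
    rw [col_prec hk, hA]; exact hξ
  · have hm : col (prec A w0) ∈ NR p := by rw [col_prec hk, hA]; exact hξ
    exact omega_iPlus hΩ (omega_ke hw0 (hKE w0 hm))
  · rintro w ⟨hw1, hw2⟩
    exact omega_ke (iPlus_omega hw2) (hKE w hw1).symm

theorem approx_smooth {D m : ℕ} {S : Set (Fin D → ℝ)} (hS : IsCompact S)
    {u : (Fin D → ℝ) → Fin m → ℝ} (hu : ContinuousOn u S) {δ : ℝ} (hδ : 0 < δ) :
    ∃ P : (Fin D → ℝ) → Fin m → ℝ, ContDiff ℝ 1 P ∧ ∀ x ∈ S, ‖P x - u x‖ < δ := by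
  obtain ⟨g, hg⟩ := ContinuousMap.exists_restrict_eq hS.isClosed
    (⟨_, continuousOn_iff_continuous_domRestrict.1 hu⟩ : C(S, Fin m → ℝ))
  have hd := ContinuousMap.dense_setOfPred_contDiff (E := Fin D → ℝ) (F := Fin m → ℝ) g
  rw [mem_closure_iff_nhds_basis
    (nhds_basis_uniformity Metric.uniformity_basis_dist.compactConvergenceUniformity)] at hd
  obtain ⟨P, hP, hP2⟩ := hd (S, δ) ⟨hS, hδ⟩
  rw [Set.mem_ofPred_eq] at hP
  refine ⟨P, hP.of_le (by exact_mod_cast le_top), fun x hx => ?_⟩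
  have h1 : g x = u x := congrArg (fun f => f ⟨x, hx⟩) hg
  have h2 := hP2 x hx
  rw [← dist_eq_norm, ← h1]
  first
    | exact h2
    | (rw [dist_comm]; exact h2)

theorem avoid {D p : ℕ} (K : Geometry.SimplicialComplex ℝ (Fin D → ℝ))
    (hfin : K.faces.Finite) (hdimK : ∀ s ∈ K.faces, s.card ≤ p)
    {P : (Fin D → ℝ) → Fin (p + 1) → ℝ} (hP : ContDiff ℝ 1 P) {δ : ℝ} (hδ : 0 < δ) :
    ∃ c : Fin (p + 1) → ℝ, ‖c‖ < δ ∧ ∀ x ∈ K.space, ∀ t : ℝ, P x + c ≠ t • eVec p := by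
  classical
  let Bs : Finset (Fin D → ℝ) → Set (Fin (p + 1) → ℝ) := fun s =>
    {c | ∃ x ∈ convexHull ℝ (s : Set (Fin D → ℝ)), ∃ t : ℝ, P x + c = t • eVec p}
  have hB : ∀ s ∈ K.faces, dimH (Bs s) ≤ (p : ENNReal) := by
    intro s hs
    obtain ⟨x0, hx0⟩ := K.nonempty_of_mem_faces hs
    let F : ℝ × ({y // y ∈ s.erase x0} → ℝ) → Fin (p + 1) → ℝ := fun q =>
      q.1 • eVec p - P (x0 + ∑ y : {y // y ∈ s.erase x0}, q.2 y • (y.1 - x0))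
    have hF : ContDiff ℝ 1 F := by
      have h1 : ContDiff ℝ 1 (fun q : ℝ × ({y // y ∈ s.erase x0} → ℝ) =>
          x0 + ∑ y : {y // y ∈ s.erase x0}, q.2 y • (y.1 - x0)) := by
        fun_prop
      exact (contDiff_fst.smul contDiff_const).sub (hP.comp h1)
    have hsub : Bs s ⊆ Set.range F := by
      rintro c ⟨x, hx, t, ht⟩
      rw [Finset.mem_convexHull'] at hx
      obtain ⟨w, -, hw1, hw⟩ := hx
      refine ⟨(t, fun y => w y.1), ?_⟩
      have hx' : x0 + ∑ y : {y // y ∈ s.erase x0}, w y.1 • (y.1 - x0) = x := by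
        rw [Finset.sum_coe_sort (s.erase x0) (fun y => w y • (y - x0))]
        have h3 : ∑ y ∈ s.erase x0, w y • (y - x0) = ∑ y ∈ s, w y • (y - x0) := by
          apply Finset.sum_erase
          simp
        rw [h3]
        simp only [smul_sub, Finset.sum_sub_distrib, ← Finset.sum_smul, hw1, hw]
        simp
      show t • eVec p - P (x0 + ∑ y : {y // y ∈ s.erase x0}, w y.1 • (y.1 - x0)) = c
      rw [hx', ← ht]; simp
    refine (dimH_mono hsub).trans (hF.dimH_range_le.trans ?_)
    have hc : (s.erase x0).card + 1 = s.card := Finset.card_erase_add_one hx0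
    have := hdimK s hs
    have h4 : Module.finrank ℝ (ℝ × ({y // y ∈ s.erase x0} → ℝ)) = 1 + (s.erase x0).card := by
      rw [Module.finrank_prod, Module.finrank_self, Module.finrank_fintype_fun_eq_card,
        Fintype.card_coe]
    rw [h4]
    exact_mod_cast (by omega : 1 + (s.erase x0).card ≤ p)
  have hd : dimH (⋃ s ∈ K.faces, Bs s) < Module.finrank ℝ (Fin (p + 1) → ℝ) := by
    rw [dimH_bUnion hfin.countable]
    refine lt_of_le_of_lt (iSup₂_le hB) ?_
    rw [Module.finrank_fintype_fun_eq_card, Fintype.card_fin]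
    exact_mod_cast Nat.lt_succ_self p
  obtain ⟨c, hc, hc2⟩ := (dense_compl_of_dimH_lt_finrank hd).exists_dist_lt 0 hδ
  refine ⟨c, by simpa [dist_eq_norm] using hc2, fun x hx t ht => hc ?_⟩
  rw [Geometry.SimplicialComplex.mem_space_iff] at hx
  obtain ⟨s, hs, hxs⟩ := hx
  exact Set.mem_biUnion hs ⟨x, hxs, t, ht⟩

/-- change the last column of the differential -/
noncomputable def addcol {k n p : ℕ} (w : JetSpace k (n + 1) (p + 1)) (c : Fin (p + 1) → ℝ) :
    JetSpace k (n + 1) (p + 1) :=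
  truncJet k (n + 1) (p + 1) fun j =>
    w.1 j + MvPolynomial.C (c j) * MvPolynomial.X (Fin.last n)

theorem continuous_addcol {k n p : ℕ} : Continuous
    (fun q : JetSpace k (n + 1) (p + 1) × (Fin (p + 1) → ℝ) => addcol q.1 q.2) :=
  cont_truncJet fun j => (cont_iff_cc.1 continuous_fst j).add
    ((cc_C (by fun_prop)).mul (cc_const _))

theorem addcol_zero {k n p : ℕ} (w : JetSpace k (n + 1) (p + 1)) : addcol w 0 = w := by
  have : addcol w 0 = truncJet k (n + 1) (p + 1) w.1 := by simp [addcol]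
  rw [this, trunc_self]

theorem col_addcol {k n p : ℕ} (hk : 1 ≤ k) (w : JetSpace k (n + 1) (p + 1))
    (c : Fin (p + 1) → ℝ) : col (addcol w c) = col w + c := by
  funext j
  simp only [col, addcol, truncJet]
  rw [coeff_truncPoly, if_pos (by simpa using hk)]
  simp [MvPolynomial.coeff_C_mul, col]

theorem tube {k n p D : ℕ} {S : Set (Fin D → ℝ)} (hS : IsCompact S)
    {ψ : (Fin D → ℝ) → JetSpace k (n + 1) (p + 1)} (hψ : ContinuousOn ψ S)
    {O : Set (JetSpace k (n + 1) (p + 1))} (hO : IsOpen O) (hm : Set.MapsTo ψ S O) :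
    ∃ δ > 0, ∀ x ∈ S, ∀ c, ‖c‖ < δ → addcol (ψ x) c ∈ O := by
  have hcS : CompactSpace S := isCompact_iff_compactSpace.1 hS
  have hc : Continuous (fun q : S × (Fin (p + 1) → ℝ) => addcol (ψ q.1) q.2) :=
    continuous_addcol.comp (f := fun q : S × (Fin (p + 1) → ℝ) => (ψ q.1, q.2))
      (((continuousOn_iff_continuous_domRestrict.1 hψ).comp continuous_fst).prodMk continuous_snd)
  obtain ⟨a, b, ha, hb, hau, hb0, hab⟩ := generalized_tube_lemma (isCompact_univ (X := S))
    (isCompact_singleton (x := (0 : Fin (p + 1) → ℝ))) (hO.preimage hc) (by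
      rintro ⟨x, c⟩ ⟨-, rfl⟩
      show addcol (ψ x) 0 ∈ O
      rw [addcol_zero]
      exact hm x.2)
  obtain ⟨δ, hδ, hball⟩ := Metric.isOpen_iff.1 hb 0 (hb0 rfl)
  refine ⟨δ, hδ, fun x hx c hcδ => ?_⟩
  exact hab (a := (⟨x, hx⟩, c)) ⟨hau trivial, hball (by simpa using hcδ)⟩

theorem space_compact {D : ℕ} (K : Geometry.SimplicialComplex ℝ (Fin D → ℝ))
    (hfin : K.faces.Finite) : IsCompact K.space :=
  hfin.isCompact_biUnion fun s _ => s.finite_toSet.isCompact_convexHull ℝ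

theorem nr_of_close {p : ℕ} {v : Fin (p + 1) → ℝ} (h : ‖v - eVec p‖ < 1) : v ∈ NR p := by
  rintro ⟨-, hl⟩
  have := (norm_le_pi_norm (v - eVec p) (Fin.last p)).trans_lt h
  simp [abs_lt] at this
  linarith [this.1]

theorem nr_of_ne {p : ℕ} {v : Fin (p + 1) → ℝ} (h : ∀ t : ℝ, v ≠ t • eVec p) : v ∈ NR p := by
  rintro ⟨hz, -⟩
  refine h (v (Fin.last p)) ?_
  funext i
  refine Fin.lastCases (by simp) (fun i => by simp [hz]) i

/-! ### Statement: Proposition 6.2 -/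

/-- **Proposition 6.2** (Ando). Let `Ω(n,p)` be a `𝒦`-invariant open subset of
`J^k(n,p)`.  Let `(K,L)` be a pair of a finite (geometric) simplicial complex and
a subcomplex with `K∖L` a manifold, `dim L < dim K` and `dim K < p`.  Let
`ψ : (K,L) → (Ω_𝒦(n+1,p+1), i_{+1}(Ω(n,p)))` be continuous and smooth on `K∖L`.
Then there is a homotopy `Ψ_λ` of maps of pairs, relative to `L`, with `Ψ₀ = ψ`
and `Ψ₁(K) ⊆ i_{+1}(Ω(n,p))`. -/
theorem proposition_6_2 (k n p D : ℕ) (hk : 1 ≤ k)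
    (Ω : Set (JetSpace k n p)) (hΩopen : IsOpen Ω) (hΩinv : KInvariant Ω)
    (K L : Geometry.SimplicialComplex ℝ (Fin D → ℝ))
    (hfin : K.faces.Finite) (hsub : L.faces ⊆ K.faces)
    (hdimK : ∀ s ∈ K.faces, s.card ≤ p)
    (hdimL : ∃ dK : ℕ, (∀ s ∈ K.faces, s.card ≤ dK + 1) ∧
      (∃ s ∈ K.faces, s.card = dK + 1) ∧ ∀ s ∈ L.faces, s.card ≤ dK)
    (hmfd : ∃ d : ℕ, Nonempty
      (ChartedSpace (EuclideanSpace ℝ (Fin d)) ↥(K.space \ L.space)))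
    (ψ : (Fin D → ℝ) → JetSpace k (n + 1) (p + 1))
    (hψc : ContinuousOn ψ K.space)
    (hψK : Set.MapsTo ψ K.space (OmegaK hk Ω 1))
    (hψL : Set.MapsTo ψ L.space (iPlusOne hk '' Ω))
    (hψsm : ContDiffOn ℝ (⊤ : ℕ∞) (fun x => jetCoeffs (ψ x)) (K.space \ L.space)) :
    ∃ Ψ : ℝ → (Fin D → ℝ) → JetSpace k (n + 1) (p + 1),
      ContinuousOn (fun q : ℝ × (Fin D → ℝ) => Ψ q.1 q.2)
        (Set.Icc (0 : ℝ) 1 ×ˢ K.space) ∧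
      (∀ x ∈ K.space, Ψ 0 x = ψ x) ∧
      (∀ t ∈ Set.Icc (0 : ℝ) 1, Set.MapsTo (Ψ t) K.space (OmegaK hk Ω 1)) ∧
      (∀ t ∈ Set.Icc (0 : ℝ) 1, Set.MapsTo (Ψ t) L.space (iPlusOne hk '' Ω)) ∧
      (∀ t ∈ Set.Icc (0 : ℝ) 1, ∀ x ∈ L.space, Ψ t x = ψ x) ∧
      Set.MapsTo (Ψ 1) K.space (iPlusOne hk '' Ω) := by
  obtain ⟨H, hHc, hH0, hHke, hH1, hHi⟩ := red (n := n) (p := p) hk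
  have hO := isOpen_omega hk hΩinv hΩopen
  have hKc := space_compact K hfin
  have hLK : L.space ⊆ K.space := by
    intro x hx
    rw [Geometry.SimplicialComplex.mem_space_iff] at hx ⊢
    obtain ⟨s, hs, hxs⟩ := hx
    exact ⟨s, hsub hs, hxs⟩
  obtain ⟨δ, hδ, htube⟩ := tube hKc hψc hO hψK
  have huc : ContinuousOn (fun x => col (ψ x)) K.space := continuous_col.comp_continuousOn hψc
  set η : ℝ := min δ (1 / 2) / 2 with hη
  have hη0 : 0 < η := by positivity
  have hη1 : η + η ≤ δ := by
    have := min_le_left δ (1 / 2)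
    linarith
  have hη2 : η + η ≤ 1 / 2 := by
    have := min_le_right δ (1 / 2)
    linarith
  obtain ⟨P, hP, hPu⟩ := approx_smooth hKc huc hη0
  obtain ⟨c, hcη, hc⟩ := avoid K hfin hdimK hP hη0
  let χ : (Fin D → ℝ) → ℝ := fun x => min 1 (2 * ‖col (ψ x) - eVec p‖)
  let g : (Fin D → ℝ) → Fin (p + 1) → ℝ := fun x => χ x • (P x - col (ψ x) + c)
  have hχ0 : ∀ x, 0 ≤ χ x := fun x => le_min zero_le_one (by positivity)
  have hχ1 : ∀ x, χ x ≤ 1 := fun x => min_le_left _ _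
  have hgn : ∀ x ∈ K.space, ‖g x‖ < η + η := by
    intro x hx
    have h1 : ‖P x - col (ψ x) + c‖ < η + η :=
      (norm_add_le _ _).trans_lt (add_lt_add (hPu x hx) hcη)
    have h2 : ‖g x‖ ≤ ‖P x - col (ψ x) + c‖ := by
      simp only [g]
      rw [norm_smul, Real.norm_of_nonneg (hχ0 x)]
      exact mul_le_of_le_one_left (norm_nonneg _) (hχ1 x)
    exact h2.trans_lt h1
  have hgc : ContinuousOn g K.space := by
    have hχc : ContinuousOn χ K.space :=
      ContinuousOn.inf continuousOn_const
        (continuousOn_const.mul (huc.sub continuousOn_const).norm)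
    exact hχc.smul ((hP.continuous.continuousOn.sub huc).add continuousOn_const)
  have hgL : ∀ x ∈ L.space, g x = 0 := by
    intro x hx
    obtain ⟨z, -, hz⟩ := hψL hx
    have : col (ψ x) = eVec p := by rw [← hz, col_iPlusOne]
    simp [g, χ, this]
  have hNR : ∀ x ∈ K.space, col (addcol (ψ x) (g x)) ∈ NR p := by
    intro x hx
    rw [col_addcol hk]
    by_cases hux : ‖col (ψ x) - eVec p‖ < 1 / 2
    · apply nr_of_close
      have e : col (ψ x) + g x - eVec p = (col (ψ x) - eVec p) + g x := by abel
      rw [e]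
      have := norm_add_le (col (ψ x) - eVec p) (g x)
      have := hgn x hx
      linarith
    · have hχ : χ x = 1 := min_eq_left (by linarith [not_lt.1 hux])
      apply nr_of_ne
      intro t ht
      refine hc x hx t ?_
      rw [← ht]
      simp only [g, hχ, one_smul]
      abel
  let f1 : ℝ × (Fin D → ℝ) → JetSpace k (n + 1) (p + 1) := fun q =>
    addcol (ψ q.2) (min 1 (2 * q.1) • g q.2)
  let f2 : ℝ × (Fin D → ℝ) → JetSpace k (n + 1) (p + 1) := fun q =>
    H (max 0 (2 * q.1 - 1)) (addcol (ψ q.2) (g q.2))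
  have hmin : ∀ t ∈ Set.Icc (0 : ℝ) 1, min 1 (2 * t) ∈ Set.Icc (0 : ℝ) 1 := fun t ht =>
    ⟨le_min zero_le_one (by linarith [ht.1]), min_le_left _ _⟩
  have hmax : ∀ t ∈ Set.Icc (0 : ℝ) 1, max 0 (2 * t - 1) ∈ Set.Icc (0 : ℝ) 1 := fun t ht =>
    ⟨le_max_left _ _, max_le zero_le_one (by linarith [ht.2])⟩
  have hψ2 : ContinuousOn (fun q : ℝ × (Fin D → ℝ) => ψ q.2) (Set.Icc (0 : ℝ) 1 ×ˢ K.space) :=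
    hψc.comp continuous_snd.continuousOn fun q hq => hq.2
  have hg2 : ContinuousOn (fun q : ℝ × (Fin D → ℝ) => g q.2) (Set.Icc (0 : ℝ) 1 ×ˢ K.space) :=
    hgc.comp continuous_snd.continuousOn fun q hq => hq.2
  have hf1 : ContinuousOn f1 (Set.Icc (0 : ℝ) 1 ×ˢ K.space) :=
    continuous_addcol.comp_continuousOn (f := fun q : ℝ × (Fin D → ℝ) =>
      (ψ q.2, min 1 (2 * q.1) • g q.2)) (hψ2.prodMk
        (ContinuousOn.smul (f := fun q : ℝ × (Fin D → ℝ) => min 1 (2 * q.1)) (by fun_prop) hg2))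
  have hf2 : ContinuousOn f2 (Set.Icc (0 : ℝ) 1 ×ˢ K.space) := by
    refine hHc.comp (f := fun q : ℝ × (Fin D → ℝ) =>
      (max 0 (2 * q.1 - 1), addcol (ψ q.2) (g q.2))) (ContinuousOn.prodMk
        (Continuous.continuousOn (by fun_prop)) ?_) ?_
    · exact continuous_addcol.comp_continuousOn (f := fun q : ℝ × (Fin D → ℝ) =>
        (ψ q.2, g q.2)) (hψ2.prodMk hg2)
    · intro q hq
      exact ⟨hmax _ hq.1, hNR _ hq.2⟩
  have hmem1 : ∀ t ∈ Set.Icc (0 : ℝ) 1, ∀ x ∈ K.space, f1 (t, x) ∈ OmegaK hk Ω 1 := by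
    intro t ht x hx
    refine htube x hx _ ?_
    rw [norm_smul, Real.norm_of_nonneg (hmin t ht).1]
    refine lt_of_le_of_lt (mul_le_of_le_one_left (norm_nonneg _) (hmin t ht).2) ?_
    exact (hgn x hx).trans_le hη1
  have hmem2 : ∀ t ∈ Set.Icc (0 : ℝ) 1, ∀ x ∈ K.space, f2 (t, x) ∈ OmegaK hk Ω 1 := by
    intro t ht x hx
    refine omega_ke (htube x hx (g x) ((hgn x hx).trans_le hη1)) ?_
    exact hHke _ (hmax t ht) _ (hNR x hx)
  have hL1 : ∀ t ∈ Set.Icc (0 : ℝ) 1, ∀ x ∈ L.space, f1 (t, x) = ψ x := by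
    intro t ht x hx
    simp only [f1, hgL x hx, smul_zero, addcol_zero]
  have hL2 : ∀ t ∈ Set.Icc (0 : ℝ) 1, ∀ x ∈ L.space, f2 (t, x) = ψ x := by
    intro t ht x hx
    obtain ⟨z, -, hz⟩ := hψL hx
    simp only [f2, hgL x hx, addcol_zero]
    rw [← hz]
    exact hHi _ (hmax t ht) z
  have hL : ∀ t ∈ Set.Icc (0 : ℝ) 1, ∀ x ∈ L.space,
      (if t ≤ 1 / 2 then f1 (t, x) else f2 (t, x)) = ψ x := by
    intro t ht x hx
    split_ifs
    · exact hL1 t ht x hx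
    · exact hL2 t ht x hx
  refine ⟨fun t x => if t ≤ 1 / 2 then f1 (t, x) else f2 (t, x), ?_, ?_, ?_, ?_, hL, ?_⟩
  · rw [continuousOn_iff_continuous_domRestrict]
    refine Continuous.if_le
      (f := fun q : (Set.Icc (0 : ℝ) 1 ×ˢ K.space : Set (ℝ × (Fin D → ℝ))) => q.1.1)
      (g := fun _ => 1 / 2)
      (continuousOn_iff_continuous_domRestrict.1 hf1)
      (continuousOn_iff_continuous_domRestrict.1 hf2) (by fun_prop) continuous_const ?_
    rintro ⟨⟨t, x⟩, ht, hx⟩ h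
    have h' : t = 1 / 2 := h
    subst h'
    show addcol (ψ x) (min 1 (2 * (1 / 2 : ℝ)) • g x) =
      H (max 0 (2 * (1 / 2 : ℝ) - 1)) (addcol (ψ x) (g x))
    have e1 : min 1 (2 * (1 / 2 : ℝ)) = 1 := by norm_num
    have e2 : max 0 (2 * (1 / 2 : ℝ) - 1) = 0 := by norm_num
    rw [e1, e2, one_smul, hH0 _ (hNR x hx)]
  · intro x hx
    have h0 : (0 : ℝ) ≤ 1 / 2 := by norm_num
    simp only [h0, if_true, f1, mul_zero]
    have e1 : min 1 (0 : ℝ) = 0 := by norm_num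
    rw [e1, zero_smul, addcol_zero]
  · intro t ht x hx
    dsimp only
    split_ifs
    · exact hmem1 t ht x hx
    · exact hmem2 t ht x hx
  · intro t ht x hx
    dsimp only
    rw [hL t ht x hx]
    exact hψL hx
  · intro x hx
    have h0 : ¬ ((1 : ℝ) ≤ 1 / 2) := by norm_num
    dsimp only
    rw [if_neg h0]
    have hm := hmem2 1 ⟨zero_le_one, le_rfl⟩ x hx
    have e2 : max 0 (2 * (1 : ℝ) - 1) = 1 := by norm_num
    have hf : f2 (1, x) = H 1 (addcol (ψ x) (g x)) := by
      simp only [f2, e2]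
    obtain ⟨z, hz⟩ := hH1 _ (hNR x hx)
    rw [hf, hz] at hm ⊢
    exact ⟨z, omega_iPlus hΩinv hm, rfl⟩

end AndoCob
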